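/- Let G be a connected graph. If G contains no induced claw, tent S_3, net, or C_4, then G is either a fat W_5 or a proper Helly circular-arc graph. -/

import Mathlib

/-- A unit interval graph: vertices can be mapped to reals so that two distinct
vertices are adjacent iff their images are within distance 1. -/
def SimpleGraph.IsUnitIntervalGraph {V : Type*} (G : SimpleGraph V) : Prop :=
  ∃ f : V → ℝ, ∀ u v : V, u ≠ v → (G.Adj u v ↔ |f u - f v| ≤ 1)

/-- `f : ZMod n → V` describes a hole (induced cycle of length `n ≥ 4`) of `G`. -/
def SimpleGraph.IsHoleOn {V : Type*} (G : SimpleGraph V) (n : ℕ) (f : ZMod n → V) : Prop :=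
  4 ≤ n ∧ Function.Injective f ∧
    ∀ i j : ZMod n, (G.Adj (f i) (f j) ↔ (i = j + 1 ∨ j = i + 1))

def SimpleGraph.HasHole {V : Type*} (G : SimpleGraph V) : Prop :=
  ∃ (n : ℕ) (f : ZMod n → V), G.IsHoleOn n f

/-- A graph is chordal if it has no hole. -/
def SimpleGraph.Chordal {V : Type*} (G : SimpleGraph V) : Prop := ¬ G.HasHole

/-- `G` contains an induced copy of `H`. -/
def SimpleGraph.HasInducedCopy {V W : Type*} (G : SimpleGraph V) (H : SimpleGraph W) : Prop :=
  ∃ f : W → V, Function.Injective f ∧ ∀ a b : W, G.Adj (f a) (f b) ↔ H.Adj a b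

/-- The claw `K_{1,3}`, centered at vertex `0`. -/
def clawGraph : SimpleGraph (Fin 4) := SimpleGraph.fromRel (fun a _ => a = 0)

/-- The tent `S_3`: triangle on `0,1,2`; vertex `i+3` adjacent to `{0,1,2} \ {i}`. -/
def tentGraph : SimpleGraph (Fin 6) := SimpleGraph.fromRel (fun a b =>
  (a.val < 3 ∧ b.val < 3) ∨ (a.val < 3 ∧ 3 ≤ b.val ∧ b.val ≠ a.val + 3))

/-- The net: triangle on `0,1,2`; pendant vertex `i+3` adjacent exactly to `i`. -/
def netGraph : SimpleGraph (Fin 6) := SimpleGraph.fromRel (fun a b =>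
  (a.val < 3 ∧ b.val < 3) ∨ (a.val < 3 ∧ b.val = a.val + 3))

/-- The cycle `C_n` on `ZMod n`. -/
def cycleG (n : ℕ) : SimpleGraph (ZMod n) := SimpleGraph.fromRel (fun a b => a = b + 1)

/-- The wheel `W_n`: a cycle `C_n` plus a hub (`none`) adjacent to all cycle vertices. -/
def wheelG (n : ℕ) : SimpleGraph (Option (ZMod n)) := SimpleGraph.fromRel (fun a b =>
  a = none ∨ ∃ i j : ZMod n, a = some i ∧ b = some j ∧ i = j + 1)

/-- `C*_n`: a cycle `C_n` plus an isolated vertex (`none`). -/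
def cycleStarG (n : ℕ) : SimpleGraph (Option (ZMod n)) := SimpleGraph.fromRel (fun a b =>
  ∃ i j : ZMod n, a = some i ∧ b = some j ∧ i = j + 1)

/-- Raw data of a family of closed arcs on the circle `ℝ/Lℤ`: each vertex `v` gets the
arc traversed clockwise from (the image of) `src v` to `src v + len v`. -/
structure PreArcModel (V : Type*) where
  L : ℝ
  L_pos : 0 < L
  src : V → ℝ
  len : V → ℝ
  len_pos : ∀ v, 0 < len v
  len_lt : ∀ v, len v < L

namespace PreArcModel

variable {V : Type*}

/-- The counterclockwise endpoint of the arc of `v`. -/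
noncomputable def ccp (A : PreArcModel V) (v : V) : AddCircle A.L := (A.src v : ℝ)

/-- The clockwise endpoint of the arc of `v`. -/
noncomputable def cp (A : PreArcModel V) (v : V) : AddCircle A.L :=
  ((A.src v + A.len v : ℝ) : AddCircle A.L)

/-- The closed arc assigned to `v`, as a subset of the circle. -/
noncomputable def arc (A : PreArcModel V) (v : V) : Set (AddCircle A.L) :=
  (fun x : ℝ => (x : AddCircle A.L)) '' Set.Icc (A.src v) (A.src v + A.len v)

/-- All endpoints of all arcs are pairwise distinct. -/
def EndpointsDistinct (A : PreArcModel V) : Prop :=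
  Function.Injective (fun p : V × Bool => if p.2 then A.cp p.1 else A.ccp p.1)

/-- `A` is an arc model of the graph `G`: endpoints are pairwise distinct and two
distinct vertices are adjacent iff their arcs intersect. -/
def IsModelOf (A : PreArcModel V) (G : SimpleGraph V) : Prop :=
  A.EndpointsDistinct ∧ ∀ u v : V, u ≠ v → (G.Adj u v ↔ (A.arc u ∩ A.arc v).Nonempty)

/-- No arc is properly contained in another arc. -/
def Proper (A : PreArcModel V) : Prop := ∀ u v : V, ¬ A.arc u ⊂ A.arc v

/-- Every set of pairwise intersecting arcs has a common point. -/
def Helly (A : PreArcModel V) : Prop :=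
  ∀ S : Set V, (∀ u ∈ S, ∀ v ∈ S, (A.arc u ∩ A.arc v).Nonempty) →
    (⋂ v ∈ S, A.arc v).Nonempty

/-- The set `K_A(α)` of vertices whose arc contains the point `α`. -/
noncomputable def K (A : PreArcModel V) (α : AddCircle A.L) : Set V := {v | α ∈ A.arc v}

/-- The edge set `E→_A(α)`: edges `vu` of `G` with `v ∈ K_A(α)`, `u ∉ K_A(α)`,
and `A(v)` intersecting `A(u)` from the left (`cp v ∈ A(u)`). -/
noncomputable def Eout (A : PreArcModel V) (G : SimpleGraph V) (α : AddCircle A.L) :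
    Set (Sym2 V) :=
  {e | ∃ v u : V, e = s(v, u) ∧ G.Adj v u ∧ α ∈ A.arc v ∧ α ∉ A.arc u ∧ A.cp v ∈ A.arc u}

/-- The edge set `E→_{A - Vm}(α)` of the model obtained by removing the arcs of `Vm`. -/
noncomputable def EoutAvoid (A : PreArcModel V) (G : SimpleGraph V) (Vm : Set V)
    (α : AddCircle A.L) : Set (Sym2 V) :=
  {e | ∃ v u : V, e = s(v, u) ∧ G.Adj v u ∧ v ∉ Vm ∧ u ∉ Vm ∧
    α ∈ A.arc v ∧ α ∉ A.arc u ∧ A.cp v ∈ A.arc u}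

end PreArcModel

/-- A proper Helly circular-arc graph: a graph admitting an arc model that is both
proper and Helly. -/
def SimpleGraph.IsPHCA {V : Type*} (G : SimpleGraph V) : Prop :=
  ∃ A : PreArcModel V, A.IsModelOf G ∧ A.Proper ∧ A.Helly

/-- Adjacency pattern of a fat `W_5` among the six clique-classes: classes `0..4`
form the fat hole (consecutive classes modulo 5 are completely adjacent), class `5`
is the hub (completely adjacent to everything), and each class is a clique. -/
def fatW5Rel (p q : Fin 6) : Prop :=
  p = q ∨ p = 5 ∨ q = 5 ∨ (p.val + 1) % 5 = q.val ∨ (q.val + 1) % 5 = p.val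

/-- A fat `W_5`: vertex set partitioned into six nonempty cliques with the `W_5`
adjacency pattern between the classes. -/
def SimpleGraph.IsFatW5 {V : Type*} (G : SimpleGraph V) : Prop :=
  ∃ part : V → Fin 6, Function.Surjective part ∧
    ∀ u v : V, u ≠ v → (G.Adj u v ↔ fatW5Rel (part u) (part v))

/-- `Gb` is a maximum spanning unit interval subgraph of `G`. -/
def IsMaxSpanningUIG {V : Type*} (G Gb : SimpleGraph V) : Prop :=
  Gb ≤ G ∧ Gb.IsUnitIntervalGraph ∧
    ∀ H : SimpleGraph V, H ≤ G → H.IsUnitIntervalGraph →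
      H.edgeSet.ncard ≤ Gb.edgeSet.ncard

/-- `(Vm, Em, Ep)` is an editing set of `G`: `Em` is a set of edges of `G - Vm`,
`Ep` a set of non-edges of `G - Vm`, and deleting `Em` and adding `Ep` makes
`G - Vm` a unit interval graph. -/
def IsEditingSet {V : Type*} (G : SimpleGraph V) (Vm : Set V) (Em Ep : Set (Sym2 V)) : Prop :=
  Em ⊆ G.edgeSet ∧ (∀ e ∈ Em, ∀ x ∈ e, x ∉ Vm) ∧
  (∀ e ∈ Ep, ¬ e.IsDiag ∧ e ∉ G.edgeSet ∧ ∀ x ∈ e, x ∉ Vm) ∧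
  ((SimpleGraph.fromEdgeSet ((G.edgeSet \ Em) ∪ Ep)).induce {v | v ∉ Vm}).IsUnitIntervalGraph

/-- Adjacent or equal. -/
def SimpleGraph.AdjEq {V : Type*} (G : SimpleGraph V) (x y : V) : Prop := x = y ∨ G.Adj x y

/-- Elementwise form of the absence of induced claws, tents, nets and four-cycles. -/
structure SimpleGraph.ForbFree {V : Type*} (G : SimpleGraph V) : Prop where
  claw : ∀ c x y z : V, G.Adj c x → G.Adj c y → G.Adj c z → x ≠ y → x ≠ z → y ≠ z →
    ¬ G.Adj x y → ¬ G.Adj x z → ¬ G.Adj y z → False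
  c4 : ∀ a b c d : V, G.Adj a b → G.Adj b c → G.Adj c d → G.Adj d a → a ≠ c → b ≠ d →
    ¬ G.Adj a c → ¬ G.Adj b d → False
  net : ∀ a b c x y z : V, G.Adj a b → G.Adj a c → G.Adj b c → G.Adj a x → G.Adj b y → G.Adj c z →
    ¬ G.Adj a y → ¬ G.Adj a z → ¬ G.Adj b x → ¬ G.Adj b z → ¬ G.Adj c x → ¬ G.Adj c y →
    ¬ G.Adj x y → ¬ G.Adj x z → ¬ G.Adj y z → False
  tent : ∀ a b c x y z : V, G.Adj a b → G.Adj a c → G.Adj b c → ¬ G.Adj a x → ¬ G.Adj b y →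
    ¬ G.Adj c z → G.Adj a y → G.Adj a z → G.Adj b x → G.Adj b z → G.Adj c x → G.Adj c y →
    ¬ G.Adj x y → ¬ G.Adj x z → ¬ G.Adj y z → False

theorem SimpleGraph.ForbFree.of_noInducedCopy {V : Type*} {G : SimpleGraph V}
    (hclaw : ¬ G.HasInducedCopy clawGraph) (htent : ¬ G.HasInducedCopy tentGraph)
    (hnet : ¬ G.HasInducedCopy netGraph) (hc4 : ¬ G.HasInducedCopy (cycleG 4)) :
    G.ForbFree where
  claw c x y z h1 h2 h3 n1 n2 n3 a1 a2 a3 := by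
    have e1 := h1.ne; have e2 := h2.ne; have e3 := h3.ne
    refine hclaw ⟨![c, x, y, z], ?_, ?_⟩
    · intro i j h
      fin_cases i <;> fin_cases j <;> simp_all
    · intro i j
      fin_cases i <;> fin_cases j <;> simp_all [clawGraph, G.adj_comm]
  c4 a b c d h1 h2 h3 h4 n1 n2 a1 a2 := by
    have e1 := h1.ne; have e2 := h2.ne; have e3 := h3.ne; have e4 := h4.ne
    refine hc4 ⟨(![a, b, c, d] : Fin 4 → V), ?_, ?_⟩
    · intro (i : Fin 4) (j : Fin 4) h
      fin_cases i <;> fin_cases j <;> first | rfl | simp_all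
    · have key : ∀ i j : Fin 4, (cycleG 4).Adj i j ↔ (i = j + 1 ∨ j = i + 1) := by
        intro i j
        have : ∀ i j : Fin 4, (i ≠ j ∧ (i = j + 1 ∨ j = i + 1)) ↔ (i = j + 1 ∨ j = i + 1) := by
          decide
        exact (SimpleGraph.fromRel_adj _ _ _).trans (this i j)
      intro (i : Fin 4) (j : Fin 4)
      rw [key]
      fin_cases i <;> fin_cases j <;> simp_all [G.adj_comm]
  net a b c x y z h1 h2 h3 h4 h5 h6 a1 a2 a3 a4 a5 a6 a7 a8 a9 := by
    have e1 := h1.ne; have e2 := h2.ne; have e3 := h3.ne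
    have e4 := h4.ne; have e5 := h5.ne; have e6 := h6.ne
    have d1 : a ≠ y := by grind [G.adj_comm]
    have d2 : a ≠ z := by grind [G.adj_comm]
    have d3 : b ≠ x := by grind [G.adj_comm]
    have d4 : b ≠ z := by grind [G.adj_comm]
    have d5 : c ≠ x := by grind [G.adj_comm]
    have d6 : c ≠ y := by grind [G.adj_comm]
    have d7 : x ≠ y := by grind [G.adj_comm]
    have d8 : x ≠ z := by grind [G.adj_comm]
    have d9 : y ≠ z := by grind [G.adj_comm]
    refine hnet ⟨![a, b, c, x, y, z], ?_, ?_⟩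
    · intro i j h
      fin_cases i <;> fin_cases j <;> simp_all
    · intro i j
      fin_cases i <;> fin_cases j <;> simp_all [netGraph, G.adj_comm]
  tent a b c x y z h1 h2 h3 a1 a2 a3 h4 h5 h6 h7 h8 h9 a4 a5 a6 := by
    have e1 := h1.ne; have e2 := h2.ne; have e3 := h3.ne
    have e4 := h4.ne; have e5 := h5.ne; have e6 := h6.ne
    have e7 := h7.ne; have e8 := h8.ne; have e9 := h9.ne
    have d1 : a ≠ x := by grind [G.adj_comm]
    have d2 : b ≠ y := by grind [G.adj_comm]
    have d3 : c ≠ z := by grind [G.adj_comm]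
    have d7 : x ≠ y := by grind [G.adj_comm]
    have d8 : x ≠ z := by grind [G.adj_comm]
    have d9 : y ≠ z := by grind [G.adj_comm]
    refine htent ⟨![a, b, c, x, y, z], ?_, ?_⟩
    · intro i j h
      fin_cases i <;> fin_cases j <;> simp_all
    · intro i j
      fin_cases i <;> fin_cases j <;> simp_all [tentGraph, G.adj_comm]

/-- Integer data from which a proper Helly arc model can be read off: every vertex sits at an
integer position on a cycle of length `L`, and its arc reaches `R` units clockwise. -/
structure OffsetModel {V : Type*} (G : SimpleGraph V) where
  L : ℤ
  pos : V → ℤ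
  R : V → ℤ
  L_pos : 0 < L
  R_nonneg : ∀ v, 0 ≤ R v
  R_lt : ∀ v, R v < L
  pos_inj : ∀ u v, L ∣ pos v - pos u → u = v
  adj_iff : ∀ u v, u ≠ v → (G.Adj u v ↔
    (∃ d, 0 ≤ d ∧ d ≤ R u ∧ L ∣ pos v - pos u - d) ∨
    (∃ d, 0 ≤ d ∧ d ≤ R v ∧ L ∣ pos u - pos v - d))
  proper : ∀ u v d, 0 ≤ d → d ≤ R u → L ∣ pos v - pos u - d → R u ≤ d + R v
  helly : ∀ u v w d e f, 0 ≤ d → d ≤ R u → L ∣ pos v - pos u - d →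
    0 ≤ e → e ≤ R v → L ∣ pos w - pos v - e →
    0 ≤ f → f ≤ R w → L ∣ pos u - pos w - f → d + e + f = 0

namespace OffsetModel

variable {V : Type*} {G : SimpleGraph V} (M : OffsetModel G)

/-- The position of `v` lies `d` units clockwise from that of `u`, within the reach of `u`. -/
def Step (u v : V) (d : ℤ) : Prop := 0 ≤ d ∧ d ≤ M.R u ∧ M.L ∣ M.pos v - M.pos u - d

theorem step_refl (u : V) : M.Step u u 0 := ⟨le_rfl, M.R_nonneg u, by simp⟩

theorem step_antisymm {u v : V} {d e : ℤ} (h : M.Step u v d) (h' : M.Step v u e) : d + e = 0 := by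
  have := M.helly u v u d e 0 h.1 h.2.1 h.2.2 h'.1 h'.2.1 h'.2.2 le_rfl (M.R_nonneg u) (by simp)
  omega

/-- Arc lengths: the reach plus a fraction which decreases with the reach. -/
noncomputable def arcLen (v : V) : ℝ := M.R v + (1 / 2 - M.R v / (4 * M.L))

theorem frac_bounds (v : V) :
    (1 / 4 : ℝ) < 1 / 2 - M.R v / (4 * M.L) ∧ (1 / 2 - M.R v / (4 * M.L) : ℝ) ≤ 1 / 2 := by
  have hL : (0 : ℝ) < M.L := by exact_mod_cast M.L_pos
  have h0 : (0 : ℝ) ≤ M.R v := by exact_mod_cast M.R_nonneg v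
  have h1 : (M.R v : ℝ) < M.L := by exact_mod_cast M.R_lt v
  constructor
  · have : (M.R v : ℝ) / (4 * M.L) < 1 / 4 := by
      rw [div_lt_div_iff₀ (by positivity) (by norm_num)]; linarith
    linarith
  · have : (0 : ℝ) ≤ M.R v / (4 * M.L) := by positivity
    linarith

theorem le_arcLen_iff (v : V) (d : ℤ) : (d : ℝ) ≤ M.arcLen v ↔ d ≤ M.R v := by
  have h := M.frac_bounds v
  constructor
  · intro hd
    have : (d : ℝ) < M.R v + 1 := by unfold arcLen at hd; linarith
    have : d < M.R v + 1 := by exact_mod_cast this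
    omega
  · intro hd
    have : (d : ℝ) ≤ M.R v := by exact_mod_cast hd
    unfold arcLen; linarith

/-- The arc model read off from the offset data. -/
noncomputable def arcModel : PreArcModel V where
  L := M.L
  L_pos := by exact_mod_cast M.L_pos
  src v := M.pos v
  len := M.arcLen
  len_pos v := by
    have h := M.frac_bounds v
    have h0 : (0 : ℝ) ≤ M.R v := by exact_mod_cast M.R_nonneg v
    unfold arcLen; linarith
  len_lt v := by
    have h := M.frac_bounds v
    have h0 : (M.R v : ℝ) + 1 ≤ M.L := by exact_mod_cast M.R_lt v
    unfold arcLen; linarith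

theorem coe_eq_iff (x y : ℝ) :
    ((x : AddCircle M.arcModel.L) = (y : AddCircle M.arcModel.L)) ↔ ∃ k : ℤ, x - y = k * M.L := by
  rw [← sub_eq_zero, ← AddCircle.coe_sub, AddCircle.coe_eq_zero_iff]
  constructor
  · rintro ⟨k, hk⟩; exact ⟨k, by rw [← hk]; simp [arcModel]⟩
  · rintro ⟨k, hk⟩; exact ⟨k, by rw [hk]; simp [arcModel]⟩

theorem mem_arc_iff (v : V) (x : ℝ) : ((x : AddCircle M.arcModel.L) ∈ M.arcModel.arc v) ↔
    ∃ k : ℤ, M.pos v ≤ x + k * M.L ∧ x + k * M.L ≤ M.pos v + M.arcLen v := by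
  constructor
  · rintro ⟨t, ⟨ht1, ht2⟩, ht⟩
    obtain ⟨k, hk⟩ := (M.coe_eq_iff t x).1 ht
    have : x + k * M.L = t := by linarith
    exact ⟨k, by rw [this]; exact ht1, by rw [this]; exact ht2⟩
  · rintro ⟨k, h1, h2⟩
    exact ⟨x + k * M.L, ⟨h1, h2⟩, (M.coe_eq_iff _ _).2 ⟨k, by ring⟩⟩

theorem src_mem_arc_iff (u v : V) :
    (((M.pos v : ℝ) : AddCircle M.arcModel.L) ∈ M.arcModel.arc u) ↔ ∃ d, M.Step u v d := by
  rw [mem_arc_iff]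
  constructor
  · rintro ⟨k, h1, h2⟩
    have h1' : M.pos u ≤ M.pos v + k * M.L := by exact_mod_cast h1
    have h2' : ((M.pos v + k * M.L - M.pos u : ℤ) : ℝ) ≤ M.arcLen u := by push_cast; linarith
    rw [le_arcLen_iff] at h2'
    exact ⟨_, by omega, h2', ⟨-k, by ring⟩⟩
  · rintro ⟨d, h0, h1, k, hk⟩
    have h3 := (M.le_arcLen_iff u d).2 h1
    have h4 : (0 : ℝ) ≤ d := by exact_mod_cast h0
    have h5 : (M.pos v : ℝ) - M.pos u - d = M.L * k := by exact_mod_cast hk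
    refine ⟨-k, ?_, ?_⟩ <;> push_cast <;> linarith

theorem arc_inter_iff (u v : V) : (M.arcModel.arc u ∩ M.arcModel.arc v).Nonempty ↔
    (∃ d, M.Step u v d) ∨ (∃ d, M.Step v u d) := by
  constructor
  · rintro ⟨p, ⟨t, ⟨ht1, ht2⟩, rfl⟩, hv⟩
    obtain ⟨k, h1, h2⟩ := (M.mem_arc_iff v t).1 hv
    change (M.pos u : ℝ) ≤ t at ht1
    change t ≤ (M.pos u : ℝ) + M.arcLen u at ht2
    by_cases h : (M.pos u : ℝ) + k * M.L ≤ M.pos v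
    · left
      rw [← src_mem_arc_iff, mem_arc_iff]
      exact ⟨-k, by push_cast; linarith, by push_cast; linarith⟩
    · right
      rw [← src_mem_arc_iff, mem_arc_iff]
      exact ⟨k, by linarith, by linarith⟩
  · have key : ∀ u v, (∃ d, M.Step u v d) → (M.arcModel.arc u ∩ M.arcModel.arc v).Nonempty := by
      intro u v h
      exact ⟨_, (M.src_mem_arc_iff u v).2 h, (M.src_mem_arc_iff v v).2 ⟨0, M.step_refl v⟩⟩
    rintro (h | h)
    · exact key u v h
    · rw [Set.inter_comm]; exact key v u h

theorem frac_sub_lt (u v : V) :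
    |(M.R u : ℝ) / (4 * M.L) - M.R v / (4 * M.L)| < 1 / 4 := by
  have h1 := M.frac_bounds u
  have h2 := M.frac_bounds v
  rw [abs_lt]; constructor <;> linarith

theorem endpointsDistinct : M.arcModel.EndpointsDistinct := by
  have hL : (0 : ℝ) < M.L := by exact_mod_cast M.L_pos
  have h1 : ∀ u v, M.arcModel.ccp u = M.arcModel.ccp v → u = v := by
    intro u v h
    obtain ⟨k, hk⟩ := (M.coe_eq_iff (M.pos u) (M.pos v)).1 h
    have hk' : M.pos u - M.pos v = k * M.L := by exact_mod_cast hk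
    exact (M.pos_inj v u ⟨k, by linarith⟩).symm
  have h2 : ∀ u v, M.arcModel.cp u ≠ M.arcModel.ccp v := by
    intro u v h
    obtain ⟨k, hk⟩ := (M.coe_eq_iff (M.pos u + M.arcLen u) (M.pos v)).1 h
    have hf := M.frac_bounds u
    unfold arcLen at hk
    have e : ((k * M.L + M.pos v - M.pos u - M.R u : ℤ) : ℝ) = 1 / 2 - M.R u / (4 * M.L) := by
      push_cast; linarith
    have a1 : (0 : ℝ) < ((k * M.L + M.pos v - M.pos u - M.R u : ℤ) : ℝ) := by linarith
    have a2 : ((k * M.L + M.pos v - M.pos u - M.R u : ℤ) : ℝ) < 1 := by linarith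
    have a1' := Int.cast_pos.1 a1
    have a2' : (k * M.L + M.pos v - M.pos u - M.R u : ℤ) < 1 := by exact_mod_cast a2
    omega
  have h3 : ∀ u v, M.arcModel.cp u = M.arcModel.cp v → u = v := by
    intro u v h
    obtain ⟨k, hk⟩ := (M.coe_eq_iff (M.pos u + M.arcLen u) (M.pos v + M.arcLen v)).1 h
    have hf := abs_lt.1 (M.frac_sub_lt u v)
    unfold arcLen at hk
    have e : ((M.pos u + M.R u - M.pos v - M.R v - k * M.L : ℤ) : ℝ) =
        M.R u / (4 * M.L) - M.R v / (4 * M.L) := by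
      push_cast; linarith
    have a1 : (-1 : ℝ) < ((M.pos u + M.R u - M.pos v - M.R v - k * M.L : ℤ) : ℝ) := by linarith
    have a2 : ((M.pos u + M.R u - M.pos v - M.R v - k * M.L : ℤ) : ℝ) < 1 := by linarith
    have a1' : -1 < (M.pos u + M.R u - M.pos v - M.R v - k * M.L : ℤ) := by exact_mod_cast a1
    have a2' : (M.pos u + M.R u - M.pos v - M.R v - k * M.L : ℤ) < 1 := by exact_mod_cast a2
    have a3 : (M.pos u + M.R u - M.pos v - M.R v - k * M.L : ℤ) = 0 := by omega
    rw [a3, Int.cast_zero, ← sub_div, eq_comm, div_eq_zero_iff] at e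
    have a4 : (M.R u : ℝ) - M.R v = 0 := by
      rcases e with e | e
      · exact e
      · linarith
    have a5 : M.R u - M.R v = 0 := by exact_mod_cast a4
    exact (M.pos_inj v u ⟨k, by linarith⟩).symm
  rintro ⟨u, b⟩ ⟨v, b'⟩ h
  cases b <;> cases b' <;> simp only [Bool.false_eq_true, if_true, if_false] at h
  · rw [h1 u v h]
  · exact (h2 v u h.symm).elim
  · exact (h2 u v h).elim
  · rw [h3 u v h]

theorem isModelOf : M.arcModel.IsModelOf G :=
  ⟨M.endpointsDistinct, fun u v huv => by rw [M.arc_inter_iff]; exact M.adj_iff u v huv⟩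

theorem arcModel_proper : M.arcModel.Proper := by
  intro u v h
  have huv : u ≠ v := by rintro rfl; exact h.2 subset_rfl
  have hL : (0 : ℝ) < M.L := by exact_mod_cast M.L_pos
  obtain ⟨d, hd⟩ := (M.src_mem_arc_iff v u).1
    (h.1 ((M.src_mem_arc_iff u u).2 ⟨0, M.step_refl u⟩))
  have hd0 : d ≠ 0 := by
    rintro rfl
    exact huv (M.pos_inj v u (by simpa using hd.2.2)).symm
  have hd1 : 0 < d := lt_of_le_of_ne hd.1 hd0.symm
  obtain ⟨k, hk⟩ := hd.2.2
  have hend : (((M.pos u + M.arcLen u : ℝ)) : AddCircle M.arcModel.L) ∈ M.arcModel.arc u :=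
    ⟨_, ⟨le_add_of_nonneg_right (M.arcModel.len_pos u).le, le_rfl⟩, rfl⟩
  obtain ⟨l, h1, h2⟩ := (M.mem_arc_iff v _).1 (h.1 hend)
  have hk' : (M.pos u : ℝ) - M.pos v - d = M.L * k := by exact_mod_cast hk
  have hR := M.proper v u d hd.1 hd.2.1 hd.2.2
  have hlt : M.arcLen v < d + M.arcLen u := by
    have hfu := M.frac_bounds u
    have hfv := M.frac_bounds v
    rcases hR.lt_or_eq with hR | hR
    · have : (M.R v : ℝ) + 1 ≤ d + M.R u := by exact_mod_cast hR
      unfold arcLen; linarith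
    · have e : (M.R v : ℝ) = d + M.R u := by exact_mod_cast hR
      have hd1' : (0 : ℝ) < d := by exact_mod_cast hd1
      have : (M.R u : ℝ) / (4 * M.L) < M.R v / (4 * M.L) := by
        apply div_lt_div_of_pos_right _ (by positivity); linarith
      unfold arcLen; linarith
  have hkl : k + l < 0 := by
    by_contra hkl
    have : (0 : ℝ) ≤ ((k + l : ℤ) : ℝ) := by exact_mod_cast not_lt.1 hkl
    push_cast at this
    nlinarith
  have hkl' : ((k + l : ℤ) : ℝ) ≤ -1 := by exact_mod_cast (by omega : k + l ≤ -1)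
  push_cast at hkl'
  have hwrap : (M.L : ℝ) ≤ d + M.arcLen u := by nlinarith
  have hstep : M.Step u v (M.L - d) := by
    refine ⟨?_, ?_, ⟨-k - 1, by linarith⟩⟩
    · have := M.R_lt v; have := hd.2.1; omega
    · rw [← le_arcLen_iff]; push_cast; linarith
  have := M.step_antisymm hd hstep
  have := M.L_pos
  omega

theorem arcModel_helly : M.arcModel.Helly := by
  intro S hS
  rcases S.eq_empty_or_nonempty with rfl | ⟨u, hu⟩
  · simp
  have hL := M.L_pos
  obtain ⟨d, ⟨w, hwS, hw⟩, hmax⟩ := Int.exists_greatest_of_bdd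
    (P := fun d => ∃ w ∈ S, M.Step u w d) ⟨M.R u, fun d ⟨w, _, hw⟩ => hw.2.1⟩
    ⟨0, u, hu, M.step_refl u⟩
  refine ⟨((M.pos w : ℝ) : AddCircle M.arcModel.L), ?_⟩
  simp only [Set.mem_iInter]
  intro v hv
  rw [src_mem_arc_iff]
  rcases (M.arc_inter_iff v w).1 (hS v hv w hwS) with h | ⟨e, he⟩
  · exact h
  have finish : e = 0 → ∃ d, M.Step v w d := by
    rintro rfl
    have : w = v := M.pos_inj w v (by simpa using he.2.2)
    subst this
    exact ⟨0, M.step_refl w⟩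
  rcases (M.arc_inter_iff u v).1 (hS u hu v hv) with ⟨g, hg⟩ | ⟨b, hb⟩
  · have hgd := hmax g ⟨v, hv, hg⟩
    obtain ⟨a, ha⟩ := he.2.2
    obtain ⟨a', ha'⟩ := hw.2.2
    obtain ⟨a'', ha''⟩ := hg.2.2
    have key : d + e - g = M.L * (a'' - a - a') := by linarith
    have he0 := he.1
    rcases lt_trichotomy (a'' - a - a') 0 with hlt | heq | hgt
    · nlinarith
    · rw [heq] at key
      exact finish (by omega)
    · exfalso
      have hge : M.L ≤ d + e - g := by nlinarith
      have hg0 := hg.1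
      have hdL : d < M.L := lt_of_le_of_lt hw.2.1 (M.R_lt u)
      have := M.step_antisymm hw (e := M.L - d)
        ⟨by omega, by have := he.2.1; omega, ⟨-a' - 1, by linarith⟩⟩
      omega
  · have := M.helly u w v d e b hw.1 hw.2.1 hw.2.2 he.1 he.2.1 he.2.2 hb.1 hb.2.1 hb.2.2
    have h1 := hw.1; have h2 := he.1; have h3 := hb.1
    exact finish (by omega)

theorem isPHCA (N : OffsetModel G) : G.IsPHCA :=
  ⟨N.arcModel, N.isModelOf, N.arcModel_proper, N.arcModel_helly⟩

end OffsetModel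

theorem ZMod.small_ne_zero {m : ℕ} (hm : 5 ≤ m) :
    (1 : ZMod m) ≠ 0 ∧ (2 : ZMod m) ≠ 0 ∧ (3 : ZMod m) ≠ 0 ∧ (4 : ZMod m) ≠ 0 := by
  have key : ∀ k : ℕ, 0 < k → k < 5 → ((k : ℕ) : ZMod m) ≠ 0 := by
    intro k h0 h5 h
    rw [ZMod.natCast_eq_zero_iff] at h
    have := Nat.le_of_dvd h0 h
    omega
  exact ⟨by exact_mod_cast key 1 (by omega) (by omega), by exact_mod_cast key 2 (by omega) (by omega),
    by exact_mod_cast key 3 (by omega) (by omega), by exact_mod_cast key 4 (by omega) (by omega)⟩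

theorem exists_injective_refining {V : Type*} [Fintype V] (rank : V → ℤ) :
    ∃ (s : V → ℤ) (S : ℤ), 0 < S ∧ Function.Injective s ∧ (∀ v, 0 ≤ s v ∧ s v < S) ∧
      ∀ u v, s u ≤ s v → rank u ≤ rank v := by
  classical
  let N : ℤ := Fintype.card V + 1
  let e := Fintype.equivFin V
  obtain ⟨b, hb⟩ : ∃ b : ℤ, ∀ v, |rank v| ≤ b := by
    obtain ⟨b, hb⟩ := (Set.finite_range fun v => |rank v|).bddAbove
    exact ⟨b, fun v => hb ⟨v, rfl⟩⟩
  have hN : ∀ v, 0 ≤ ((e v : ℕ) : ℤ) ∧ ((e v : ℕ) : ℤ) < N := fun v => by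
    have := (e v).2; constructor <;> omega
  have hmono : ∀ u v, (rank u + b) * N + (e u : ℕ) ≤ (rank v + b) * N + (e v : ℕ) →
      rank u ≤ rank v := by
    intro u v h
    by_contra hlt
    have h1 := hN u
    have h2 := hN v
    nlinarith
  refine ⟨fun v => (rank v + b) * N + (e v : ℕ), (2 * |b| + 1) * N, ?_, ?_, ?_, hmono⟩
  · have := abs_nonneg b
    have hN0 : 0 < N := by positivity
    positivity
  · intro u v h
    have h1 := hmono u v h.le
    have h2 := hmono v u h.ge
    have h3 : rank u = rank v := le_antisymm h1 h2
    simp only [h3, add_right_inj, Nat.cast_inj] at h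
    exact e.injective (Fin.ext h)
  · intro v
    have h1 := hN v
    have h2 := abs_le.1 (hb v)
    have h3 := le_abs_self b
    have hN0 : 0 < N := by positivity
    constructor
    · have : 0 ≤ rank v + b := by linarith
      nlinarith
    · have : rank v + b ≤ 2 * |b| := by linarith
      nlinarith

/-- A partition of the vertices into cliques arranged cyclically, adjacent vertices being at most
two classes apart, and never two classes apart twice in a row. -/
structure SimpleGraph.RoundPartition {V : Type*} (G : SimpleGraph V) (m : ℕ) where
  c : V → ZMod m
  five_le : 5 ≤ m
  clique : ∀ x y, c x = c y → x ≠ y → G.Adj x y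
  near : ∀ x y, G.Adj x y →
    c y = c x ∨ c y = c x + 1 ∨ c y = c x + 2 ∨ c x = c y + 1 ∨ c x = c y + 2
  mid : ∀ x y z, G.Adj x y → c y = c x + 2 → c z = c x + 1 → G.Adj x z ∧ G.Adj z y
  no_double : ∀ x y z, G.Adj x y → G.Adj y z → c y = c x + 2 → c z = c y + 2 → False

namespace SimpleGraph.RoundPartition

variable {V : Type*} {G : SimpleGraph V} {m : ℕ} (P : G.RoundPartition m)

/-- Neighbours in the next two classes. -/
def right (x : V) : Set V := {y | G.Adj x y ∧ (P.c y = P.c x + 1 ∨ P.c y = P.c x + 2)}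

/-- Neighbours in the previous two classes. -/
def left (x : V) : Set V := {y | G.Adj x y ∧ (P.c x = P.c y + 1 ∨ P.c x = P.c y + 2)}

theorem right_nested (hG : G.ForbFree) {x y : V} (h : P.c x = P.c y) :
    P.right x ⊆ P.right y ∨ P.right y ⊆ P.right x := by
  by_contra hcon
  push Not at hcon
  simp only [Set.not_subset] at hcon
  obtain ⟨⟨u, ⟨hu, hcu⟩, hu'⟩, ⟨w, ⟨hw, hcw⟩, hw'⟩⟩ := hcon
  obtain ⟨m1, m2, m3, m4⟩ := ZMod.small_ne_zero P.five_le
  have hyu : ¬ G.Adj y u := fun hh => hu' ⟨hh, h ▸ hcu⟩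
  have hxw : ¬ G.Adj x w := fun hh => hw' ⟨hh, h ▸ hcw⟩
  have hxy : x ≠ y := by rintro rfl; exact hyu hu
  have huw : u ≠ w := by rintro rfl; exact hyu hw
  have hc := P.clique x y h hxy
  have huw' : G.Adj u w := by
    rcases hcu with hcu | hcu <;> rcases hcw with hcw | hcw
    · exact P.clique u w (by grind) huw
    · exact (hyu (P.mid y w u hw hcw (by grind)).1).elim
    · exact (hxw (P.mid x u w hu hcu (by grind)).1).elim
    · exact P.clique u w (by grind) huw
  have hxw2 : x ≠ w := by rintro rfl; grind
  have hyu2 : y ≠ u := by rintro rfl; grind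
  exact hG.c4 x u w y hu huw' hw.symm hc.symm hxw2 hyu2.symm hxw (fun hh => hyu hh.symm)

theorem left_nested (hG : G.ForbFree) {x y : V} (h : P.c x = P.c y) :
    P.left x ⊆ P.left y ∨ P.left y ⊆ P.left x := by
  by_contra hcon
  push Not at hcon
  simp only [Set.not_subset] at hcon
  obtain ⟨⟨u, ⟨hu, hcu⟩, hu'⟩, ⟨w, ⟨hw, hcw⟩, hw'⟩⟩ := hcon
  obtain ⟨m1, m2, m3, m4⟩ := ZMod.small_ne_zero P.five_le
  have hyu : ¬ G.Adj y u := fun hh => hu' ⟨hh, h ▸ hcu⟩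
  have hxw : ¬ G.Adj x w := fun hh => hw' ⟨hh, h ▸ hcw⟩
  have hxy : x ≠ y := by rintro rfl; exact hyu hu
  have huw : u ≠ w := by rintro rfl; exact hyu hw
  have hc := P.clique x y h hxy
  have huw' : G.Adj u w := by
    rcases hcu with hcu | hcu <;> rcases hcw with hcw | hcw
    · exact P.clique u w (by grind) huw
    · exact (hyu (P.mid w y u hw.symm hcw (by grind)).2.symm).elim
    · exact (hxw (P.mid u x w hu.symm hcu (by grind)).2.symm).elim
    · exact P.clique u w (by grind) huw
  have hxw2 : x ≠ w := by
    rintro rfl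
    rcases hcw with e | e
    · exact m1 (by linear_combination -h - e)
    · exact m2 (by linear_combination -h - e)
  have hyu2 : y ≠ u := by
    rintro rfl
    rcases hcu with e | e
    · exact m1 (by linear_combination h - e)
    · exact m2 (by linear_combination h - e)
  exact hG.c4 x u w y hu huw' hw.symm hc.symm hxw2 hyu2.symm hxw (fun hh => hyu hh.symm)

theorem left_subset_of_not_right_subset (hG : G.ForbFree) {x y : V} (h : P.c x = P.c y)
    (hr : ¬ P.right x ⊆ P.right y) : P.left x ⊆ P.left y := by
  obtain ⟨u, ⟨hu, hcu⟩, hu'⟩ := Set.not_subset.1 hr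
  rintro w ⟨hw, hcw⟩
  by_contra hw'
  obtain ⟨m1, m2, m3, m4⟩ := ZMod.small_ne_zero P.five_le
  have hyu : ¬ G.Adj y u := fun hh => hu' ⟨hh, h ▸ hcu⟩
  have hyw : ¬ G.Adj y w := fun hh => hw' ⟨hh, h ▸ hcw⟩
  have hxy : x ≠ y := by rintro rfl; exact hyu hu
  have hc := P.clique x y h hxy
  have e1 : u ≠ w := by
    rintro rfl
    grind
  have e2 : y ≠ u := by grind
  have e3 : y ≠ w := by grind
  by_cases huw : G.Adj u w
  · have hstep : P.c u = P.c w + 2 → P.c y = P.c w + 1 → False := fun h1 h2 =>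
      hyw (P.mid w u y huw.symm h1 h2).1.symm
    have h22 := P.no_double u w x huw hw.symm
    have h22' := P.no_double w x u hw.symm hu
    have h22'' := P.no_double x u w hu huw
    have := P.near u w huw
    grind
  · exact hG.claw x u w y hu hw hc e1 e2.symm e3.symm huw (fun hh => hyu hh.symm)
      (fun hh => hyw hh.symm)

theorem comparable (hG : G.ForbFree) {x y : V} (h : P.c x = P.c y) :
    (P.right x ⊆ P.right y ∧ P.left y ⊆ P.left x) ∨
      (P.right y ⊆ P.right x ∧ P.left x ⊆ P.left y) := by
  by_cases h1 : P.right x ⊆ P.right y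
  · by_cases h2 : P.right y ⊆ P.right x
    · rcases P.left_nested hG h with h3 | h3
      · exact Or.inr ⟨h2, h3⟩
      · exact Or.inl ⟨h1, h3⟩
    · exact Or.inl ⟨h1, P.left_subset_of_not_right_subset hG h.symm h2⟩
  · have h2 := (P.right_nested hG h).resolve_left h1
    exact Or.inr ⟨h2, P.left_subset_of_not_right_subset hG h h1⟩

/-- An integer measuring how far to the right a vertex lies inside its class. -/
noncomputable def rank (x : V) : ℤ := (P.right x).ncard - (P.left x).ncard

theorem subset_of_rank_le [Finite V] (hG : G.ForbFree) {x y : V} (h : P.c x = P.c y)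
    (hr : P.rank x ≤ P.rank y) : P.right x ⊆ P.right y ∧ P.left y ⊆ P.left x := by
  rcases P.comparable hG h with h' | ⟨h1, h2⟩
  · exact h'
  · have c1 := Set.ncard_le_ncard h1 (Set.toFinite _)
    have c2 := Set.ncard_le_ncard h2 (Set.toFinite _)
    unfold rank at hr
    have e1 := Set.eq_of_subset_of_ncard_le h1 (by omega) (Set.toFinite _)
    have e2 := Set.eq_of_subset_of_ncard_le h2 (by omega) (Set.toFinite _)
    exact ⟨e1.ge, e2.ge⟩

/-- `y` is equal or adjacent to `x`, and lies `i` classes further. -/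
def Fwd (x y : V) (i : ℤ) : Prop :=
  (i = 0 ∨ i = 1 ∨ i = 2) ∧ P.c y = P.c x + (i : ℤ) ∧ (x = y ∨ G.Adj x y)

theorem isPHCA [Fintype V] (hG : G.ForbFree) (Q : G.RoundPartition m) : G.IsPHCA := by
  obtain ⟨s, S, hS, s_inj, s_bd, s_rank⟩ := exists_injective_refining Q.rank
  obtain ⟨m1, m2, -, -⟩ := ZMod.small_ne_zero Q.five_le
  have hm : 5 ≤ m := Q.five_le
  have : NeZero m := ⟨by omega⟩
  have hrefl : ∀ u, Q.Fwd u u 0 := fun u => ⟨Or.inl rfl, by simp, Or.inl rfl⟩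
  have hreach : ∀ u, ∃ r : ℤ, 0 ≤ r ∧ (∃ y i, Q.Fwd u y i ∧ r = S * i + s y - s u) ∧
      ∀ y i, Q.Fwd u y i → S * i + s y - s u ≤ r := by
    intro u
    obtain ⟨r, hr, hmax⟩ := Int.exists_greatest_of_bdd
      (P := fun r => ∃ y i, Q.Fwd u y i ∧ r = S * i + s y - s u)
      ⟨S * 3, by
        rintro _ ⟨y, i, hi, rfl⟩
        have h1 := s_bd y
        have h2 := s_bd u
        rcases hi.1 with rfl | rfl | rfl <;> linarith⟩
      ⟨_, u, 0, hrefl u, rfl⟩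
    refine ⟨r, ?_, hr, fun y i h => hmax _ ⟨y, i, h, rfl⟩⟩
    have := hmax _ ⟨u, 0, hrefl u, rfl⟩
    simpa using this
  choose R R0 Rex Rmax using hreach
  have clq : ∀ x y, Q.c x = Q.c y → x = y ∨ G.Adj x y := fun x y h => by
    by_cases hxy : x = y
    · exact Or.inl hxy
    · exact Or.inr (Q.clique x y h hxy)
  let pos : V → ℤ := fun v => S * ((Q.c v).val : ℤ) + s v
  have step : ∀ u v d, 0 ≤ d → d ≤ R u → (S * m) ∣ pos v - pos u - d →
      ∃ i, Q.Fwd u v i ∧ d = S * i + s v - s u := by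
    rintro u v d h0 h1 ⟨k, hk⟩
    obtain ⟨y, i, hi, hy⟩ := Rex u
    obtain ⟨j, hj⟩ : ∃ j : ℤ, j = ((Q.c v).val : ℤ) - (Q.c u).val - m * k := ⟨_, rfl⟩
    have hd : d = S * j + s v - s u := by rw [hj]; simp only [pos] at hk; linarith
    have hcv : Q.c v = Q.c u + (j : ℤ) := by rw [hj]; simp
    have bu := s_bd u
    have bv := s_bd v
    have bY := s_bd y
    have hj0 : 0 ≤ j := by
      by_contra hneg
      have : j ≤ -1 := by omega
      nlinarith
    have hji : j ≤ i := by
      by_contra hneg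
      have : i + 1 ≤ j := by omega
      nlinarith
    have hi2 : i ≤ 2 := by rcases hi.1 with h | h | h <;> omega
    have hiy := hi.2.1
    refine ⟨j, ⟨by omega, hcv, ?_⟩, hd⟩
    rcases hj0.eq_or_lt with rfl | hj0
    · exact clq u v (by simpa using hcv.symm)
    have huy : G.Adj u y := by
      rcases hi.2.2 with rfl | h
      · exfalso
        have : i = 1 ∨ i = 2 := by omega
        rcases this with rfl | rfl
        · simp [m1] at hiy
        · simp [m2] at hiy
      · exact h
    right
    rcases hji.eq_or_lt with rfl | hji
    · have hs : s v ≤ s y := by linarith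
      have hsub := (Q.subset_of_rank_le hG (hcv.trans hiy.symm) (s_rank v y hs)).2
      have : u ∈ Q.left y := by
        refine ⟨huy.symm, ?_⟩
        have : j = 1 ∨ j = 2 := by omega
        rcases this with rfl | rfl
        · left; simpa using hiy
        · right; simpa using hiy
      exact (hsub this).1.symm
    · obtain rfl : j = 1 := by omega
      obtain rfl : i = 2 := by omega
      exact (Q.mid u y v huy (by simpa using hiy) (by simpa using hcv)).1
  have step_of_fwd : ∀ u v i, Q.Fwd u v i → (S * m) ∣ pos v - pos u - (S * i + s v - s u) := by
    intro u v i hi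
    have h : (((Q.c v).val - (Q.c u).val - i : ℤ) : ZMod m) = 0 := by
      push_cast
      rw [ZMod.natCast_zmod_val, ZMod.natCast_zmod_val, hi.2.1]; ring
    obtain ⟨k, hk⟩ := (ZMod.intCast_zmod_eq_zero_iff_dvd _ m).1 h
    refine ⟨k, ?_⟩
    simp only [pos]
    linear_combination S * hk
  have fwd_nonneg : ∀ u v i, Q.Fwd u v i → i ≠ 0 → 0 ≤ S * i + s v - s u := by
    intro u v i hi h0
    have bu := s_bd u
    have bv := s_bd v
    have : 1 ≤ i := by rcases hi.1 with h | h | h <;> omega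
    nlinarith
  have R_lt : ∀ v, R v < S * m := by
    intro v
    obtain ⟨y, i, hi, hy⟩ := Rex v
    have bv := s_bd v
    have bY := s_bd y
    have hi2 : i ≤ 2 := by rcases hi.1 with h | h | h <;> omega
    have : (5 : ℤ) ≤ m := by exact_mod_cast hm
    nlinarith
  refine OffsetModel.isPHCA
    { L := S * m, pos := pos, R := R, L_pos := ?_, R_nonneg := R0, R_lt := R_lt, pos_inj := ?_,
      adj_iff := ?_, proper := ?_, helly := ?_ }
  · have : (0 : ℤ) < m := by exact_mod_cast (by omega : 0 < m)
    positivity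
  · intro u v h
    obtain ⟨i, hi, hd⟩ := step u v 0 le_rfl (R0 u) (by simpa using h)
    have h0 : i = 0 := by
      have bu := s_bd u
      have bv := s_bd v
      by_contra h0
      have : 1 ≤ i := by rcases hi.1 with h | h | h <;> omega
      nlinarith
    subst h0
    exact s_inj (by linarith)
  · intro u v huv
    have back : ∀ u v, u ≠ v → (∃ d, 0 ≤ d ∧ d ≤ R u ∧ (S * m) ∣ pos v - pos u - d) →
        G.Adj u v := by
      rintro u v huv ⟨d, h0, h1, h2⟩
      obtain ⟨i, hi, -⟩ := step u v d h0 h1 h2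
      exact hi.2.2.resolve_left huv
    have fwd : ∀ u v i, Q.Fwd u v i → 0 ≤ S * i + s v - s u →
        (∃ d, 0 ≤ d ∧ d ≤ R u ∧ (S * m) ∣ pos v - pos u - d) := fun u v i hi h0 =>
      ⟨_, h0, Rmax u v i hi, step_of_fwd u v i hi⟩
    have fwd' : ∀ u v i, i ≠ 0 → Q.Fwd u v i →
        (∃ d, 0 ≤ d ∧ d ≤ R u ∧ (S * m) ∣ pos v - pos u - d) := fun u v i h0 hi =>
      fwd u v i hi (fwd_nonneg u v i hi h0)
    constructor
    · intro h
      rcases Q.near u v h with e | e | e | e | e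
      · rcases le_total (s u) (s v) with hs | hs
        · exact Or.inl (fwd u v 0 ⟨by simp, by simpa using e, Or.inr h⟩ (by linarith))
        · exact Or.inr (fwd v u 0 ⟨by simp, by simpa using e.symm, Or.inr h.symm⟩ (by linarith))
      · exact Or.inl (fwd' u v 1 (by norm_num) ⟨by simp, by simpa using e, Or.inr h⟩)
      · exact Or.inl (fwd' u v 2 (by norm_num) ⟨by simp, by simpa using e, Or.inr h⟩)
      · exact Or.inr (fwd' v u 1 (by norm_num) ⟨by simp, by simpa using e, Or.inr h.symm⟩)
      · exact Or.inr (fwd' v u 2 (by norm_num) ⟨by simp, by simpa using e, Or.inr h.symm⟩)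
    · rintro (h | h)
      · exact back u v huv h
      · exact (back v u huv.symm h).symm
  · intro u v d h0 h1 h2
    obtain ⟨i, hi, hd⟩ := step u v d h0 h1 h2
    obtain ⟨y, k, hk, hy⟩ := Rex u
    have bv := s_bd v
    have bY := s_bd y
    have hik : i ≤ k := by
      by_contra hneg
      have : k + 1 ≤ i := by omega
      nlinarith
    have hi0 : 0 ≤ i := by rcases hi.1 with h | h | h <;> omega
    have hk2 : k ≤ 2 := by rcases hk.1 with h | h | h <;> omega
    have hcy : Q.c y = Q.c v + ((k - i : ℤ) : ZMod m) := by
      rw [hk.2.1, hi.2.1]; push_cast; ring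
    have hA : v = y ∨ G.Adj v y := by
      rcases hik.eq_or_lt with rfl | hik
      · exact clq v y (by simpa using hcy.symm)
      have hkc := hk.2.1
      have hic := hi.2.1
      have huy : G.Adj u y := by
        rcases hk.2.2 with rfl | h
        · exfalso
          have : k = 1 ∨ k = 2 := by omega
          rcases this with rfl | rfl
          · simp [m1] at hkc
          · simp [m2] at hkc
        · exact h
      right
      rcases hi0.eq_or_lt with rfl | hi0
      · have hs : s u ≤ s v := by linarith
        have hsub := (Q.subset_of_rank_le hG (by simpa using hic.symm) (s_rank u v hs)).1
        have : y ∈ Q.right u := by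
          refine ⟨huy, ?_⟩
          have : k = 1 ∨ k = 2 := by omega
          rcases this with rfl | rfl
          · left; simpa using hkc
          · right; simpa using hkc
        exact (hsub this).1
      · obtain rfl : i = 1 := by omega
        obtain rfl : k = 2 := by omega
        exact (Q.mid u y v huy (by simpa using hkc) (by simpa using hic)).2
    have := Rmax v y (k - i) ⟨by omega, hcy, hA⟩
    rw [hy, hd]
    linarith
  · intro u v w d e f d0 d1 d2 e0 e1 e2 f0 f1 f2
    obtain ⟨i, hi, hd⟩ := step u v d d0 d1 d2
    obtain ⟨j, hj, he⟩ := step v w e e0 e1 e2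
    obtain ⟨k, hk, hf⟩ := step w u f f0 f1 f2
    have hsum : ((i + j + k : ℤ) : ZMod m) = 0 := by
      have h := hk.2.1
      rw [hj.2.1, hi.2.1] at h
      push_cast
      linear_combination -h
    obtain ⟨l, hl⟩ := (ZMod.intCast_zmod_eq_zero_iff_dvd _ m).1 hsum
    have adj2 : ∀ x y, Q.Fwd x y 2 → G.Adj x y ∧ Q.c y = Q.c x + 2 := by
      intro x y h
      have hc := h.2.1
      rcases h.2.2 with rfl | h'
      · simp [m2] at hc
      · exact ⟨h', by simpa using hc⟩
    have no22 : ∀ x y z, Q.Fwd x y 2 → Q.Fwd y z 2 → False := fun x y z h h' =>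
      Q.no_double x y z (adj2 x y h).1 (adj2 y z h').1 (adj2 x y h).2 (adj2 y z h').2
    have hz : i + j + k = 0 := by
      have hsmall : i + j + k < 5 := by
        by_contra hlt
        have h1 : i ≤ 2 := by rcases hi.1 with h | h | h <;> omega
        have h2 : j ≤ 2 := by rcases hj.1 with h | h | h <;> omega
        have h3 : k ≤ 2 := by rcases hk.1 with h | h | h <;> omega
        have h4 : (i = 2 ∧ j = 2) ∨ (j = 2 ∧ k = 2) ∨ (k = 2 ∧ i = 2) := by omega
        rcases h4 with ⟨rfl, rfl⟩ | ⟨rfl, rfl⟩ | ⟨rfl, rfl⟩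
        · exact no22 _ _ _ hi hj
        · exact no22 _ _ _ hj hk
        · exact no22 _ _ _ hk hi
      have h0 : 0 ≤ i + j + k := by
        rcases hi.1 with h | h | h <;> rcases hj.1 with h' | h' | h' <;>
          rcases hk.1 with h'' | h'' | h'' <;> omega
      exact Int.eq_zero_of_dvd_of_nonneg_of_lt h0 (by omega : i + j + k < (m : ℤ)) ⟨l, hl⟩
    rw [hd, he, hf]
    linear_combination S * hz

end SimpleGraph.RoundPartition

namespace SimpleGraph

variable {V : Type*} {G : SimpleGraph V}

theorem Reachable.exists_adj_dist_eq {a x : V} {k : ℕ} (h : G.Reachable a x)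
    (hk : G.dist a x = k + 1) : ∃ p, G.Adj p x ∧ G.Reachable a p ∧ G.dist a p = k := by
  obtain ⟨w, hw⟩ := h.symm.exists_walk_length_eq_dist
  rw [dist_comm, hk] at hw
  cases w with
  | nil => simp at hw
  | @cons _ p _ hadj q =>
    rw [Walk.length_cons] at hw
    have h1 : G.dist p a ≤ k := (dist_le q).trans (by omega)
    have h2 : G.dist a x ≤ G.dist a p + 1 := by
      obtain ⟨q', hq'⟩ := q.reachable.symm.exists_walk_length_eq_dist
      rw [← hq']
      exact (dist_le (q'.concat hadj.symm)).trans (by simp)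
    rw [dist_comm] at h1
    exact ⟨p, hadj.symm, q.reachable.symm, by omega⟩

theorem Connected.dist_le_succ_of_adj (hconn : G.Connected) (a : V) {x y : V} (h : G.Adj x y) :
    G.dist a y ≤ G.dist a x + 1 := by
  have := hconn.dist_triangle (u := a) (v := x) (w := y)
  rwa [dist_eq_one_iff_adj.2 h] at this

/-- A simplicial vertex whose neighbours have nested outer neighbourhoods. -/
structure IsNestedEnd (G : SimpleGraph V) (a : V) : Prop where
  clique : ∀ u v, G.Adj a u → G.Adj a v → u ≠ v → G.Adj u v
  nested : ∀ u v x y, G.Adj a u → G.Adj a v → G.Adj u x → G.Adj v y → ¬ G.Adj u y →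
    ¬ G.Adj v x → u ≠ y → v ≠ x → False

theorem IsNestedEnd.layer_clique {a : V} (ha : G.IsNestedEnd a) (hG : G.ForbFree)
    (hconn : G.Connected) : ∀ k x y, G.dist a x = k → G.dist a y = k → x ≠ y → G.Adj x y := by
  have hd := fun x y => hconn.dist_le_succ_of_adj a (x := x) (y := y)
  have par := fun k x => (hconn a x).exists_adj_dist_eq (k := k)
  intro k
  induction k using Nat.strong_induction_on with
  | _ k ih =>
  intro x y hx hy hxy
  match k, ih, hx, hy with
  | 0, _, hx, hy =>
    rw [hconn.dist_eq_zero_iff] at hx hy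
    exact (hxy (hx.symm.trans hy)).elim
  | 1, _, hx, hy => exact ha.clique x y (dist_eq_one_iff_adj.1 hx) (dist_eq_one_iff_adj.1 hy) hxy
  | k + 2, ih, hx, hy =>
    by_contra hnadj
    have common : ∀ z, G.dist a z = k + 1 → G.Adj z x → G.Adj z y → False := by
      intro z hz hzx hzy
      obtain ⟨w, hw, -, hwd⟩ := par k z hz
      have h1 : ¬ G.Adj w x := fun h => by have := hd _ _ h; omega
      have h2 : ¬ G.Adj w y := fun h => by have := hd _ _ h; omega
      exact hG.claw z w x y hw.symm hzx hzy (by rintro rfl; omega) (by rintro rfl; omega) hxy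
        h1 h2 hnadj
    obtain ⟨u, hu, -, hud⟩ := par _ x hx
    obtain ⟨v, hv, -, hvd⟩ := par _ y hy
    have huy : ¬ G.Adj u y := fun h => common u hud hu h
    have hvx : ¬ G.Adj v x := fun h => common v hvd h hv
    have huv : u ≠ v := by rintro rfl; exact huy hv
    have huv' := ih (k + 1) (by omega) u v hud hvd huv
    have net : ∀ w, G.dist a w = k → G.Adj w u → G.Adj w v → False := by
      intro w hw hwu hwv
      match k, hw, hx, hy, hud, hvd with
      | 0, hw, hx, hy, hud, hvd =>
        exact ha.nested u v x y (dist_eq_one_iff_adj.1 hud) (dist_eq_one_iff_adj.1 hvd) hu hv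
          huy hvx (by rintro rfl; omega) (by rintro rfl; omega)
      | k + 1, hw, hx, hy, hud, hvd =>
        obtain ⟨z, hz, -, hzd⟩ := par k w hw
        refine hG.net u v w x y z huv' hwu.symm hwv.symm hu hv hz.symm huy ?_ hvx ?_ ?_ ?_ hnadj
          ?_ ?_
        all_goals
          intro h
          have h1 := hd _ _ h
          have h2 := hd _ _ h.symm
          omega
    obtain ⟨w, hw, -, hwd⟩ := par _ u hud
    obtain ⟨w', hw', -, hwd'⟩ := par _ v hvd
    have hwv : ¬ G.Adj w v := fun h => net w hwd hw h
    have hwu' : ¬ G.Adj w' u := fun h => net w' hwd' h hw'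
    have hww : w ≠ w' := by rintro rfl; exact hwv hw'
    have hww' := ih k (by omega) w w' hwd hwd' hww
    exact hG.c4 u w w' v hw.symm hww' hw' huv'.symm (by rintro rfl; omega) (by rintro rfl; omega)
      (fun h => hwu' h.symm) hwv

theorem natCast_inj_of_lt {m p q : ℕ} (hp : p < m) (hq : q < m)
    (h : (p : ZMod m) = (q : ZMod m)) : p = q := by
  rw [ZMod.natCast_eq_natCast_iff'] at h
  rwa [Nat.mod_eq_of_lt hp, Nat.mod_eq_of_lt hq] at h

theorem IsNestedEnd.isPHCA [Fintype V] {a : V} (ha : G.IsNestedEnd a) (hG : G.ForbFree)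
    (hconn : G.Connected) : G.IsPHCA := by
  obtain ⟨D, hD⟩ : ∃ D, ∀ x, G.dist a x ≤ D := by
    obtain ⟨b, hb⟩ := (Set.finite_range fun x => G.dist a x).bddAbove
    exact ⟨b, fun x => hb ⟨x, rfl⟩⟩
  have hd := fun x y => hconn.dist_le_succ_of_adj a (x := x) (y := y)
  have no2 : ∀ x y, G.Adj x y → (G.dist a y : ZMod (D + 5)) ≠ (G.dist a x : ZMod (D + 5)) + 2 := by
    intro x y hxy h
    have h1 := hD x
    have h2 := hD y
    have h3 := hd x y hxy
    have := natCast_inj_of_lt (m := D + 5) (p := G.dist a y) (q := G.dist a x + 2) (by omega)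
      (by omega) (by push_cast; exact h)
    omega
  refine RoundPartition.isPHCA hG (m := D + 5)
    { c := fun x => (G.dist a x : ZMod (D + 5)), five_le := by omega, clique := ?_, near := ?_,
      mid := fun x y z h h' _ => (no2 x y h h').elim,
      no_double := fun x y z h _ h' _ => no2 x y h h' }
  · intro x y h hxy
    have h1 := hD x
    have h2 := hD y
    exact ha.layer_clique hG hconn _ x y rfl
      (natCast_inj_of_lt (m := D + 5) (by omega) (by omega) h).symm hxy
  · intro x y h
    have h1 := hd x y h
    have h2 := hd y x h.symm
    have h3 : G.dist a y = G.dist a x ∨ G.dist a y = G.dist a x + 1 ∨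
        G.dist a x = G.dist a y + 1 := by omega
    rcases h3 with h3 | h3 | h3
    · left; rw [h3]
    · right; left; rw [h3]; push_cast; rfl
    · right; right; right; left; rw [h3]; push_cast; rfl

/-- The first `k + 1` values of `p` form an induced path. -/
def IsIndPath (G : SimpleGraph V) (p : ℕ → V) (k : ℕ) : Prop :=
  ∀ i j, i ≤ k → j ≤ k → (G.Adj (p i) (p j) ↔ (i = j + 1 ∨ j = i + 1)) ∧ (p i = p j → i = j)

theorem IsIndPath.exists_isHoleOn {p : ℕ → V} {k : ℕ} (hp : G.IsIndPath p k) (hk : 2 ≤ k) {c : V}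
    (hc : ∀ i ≤ k, (G.Adj c (p i) ↔ (i = 0 ∨ i = k))) (hne : ∀ i ≤ k, c ≠ p i) :
    ∃ f : ZMod (k + 2) → V, G.IsHoleOn (k + 2) f := by
  let f : Fin (k + 2) → V := fun i => if i.val = k + 1 then c else p i.val
  have hsucc : ∀ i : Fin (k + 2), (i + 1).val = if i.val = k + 1 then 0 else i.val + 1 := by
    intro i
    rw [Fin.val_add_one]
    simp [Fin.ext_iff]
  refine ⟨f, by omega, ?_, ?_⟩
  · intro (i : Fin (k + 2)) (j : Fin (k + 2)) h
    have hi := i.2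
    have hj := j.2
    simp only [f] at h
    apply Fin.ext
    split_ifs at h with h1 h2 h2
    · omega
    · exact (hne j.val (by omega) h).elim
    · exact (hne i.val (by omega) h.symm).elim
    · exact (hp i.val j.val (by omega) (by omega)).2 h
  · intro (i : Fin (k + 2)) (j : Fin (k + 2))
    have hi := i.2
    have hj := j.2
    have key : (i = j + 1 ∨ j = i + 1) ↔
        (i.val = (if j.val = k + 1 then 0 else j.val + 1)) ∨
        (j.val = (if i.val = k + 1 then 0 else i.val + 1)) := by
      rw [← hsucc, ← hsucc, Fin.ext_iff, Fin.ext_iff]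
    refine Iff.trans ?_ key.symm
    simp only [f]
    split_ifs with h1 h2 h2
    · simp only [G.irrefl, false_iff]; omega
    · rw [hc _ (by omega)]; omega
    · rw [G.adj_comm, hc _ (by omega)]; omega
    · rw [(hp i.val j.val (by omega) (by omega)).1]

theorem IsIndPath.cons {p : ℕ → V} {k : ℕ} (hp : G.IsIndPath p k) {c : V}
    (hc : ∀ i ≤ k, (G.Adj c (p i) ↔ i = 0)) (hne : ∀ i ≤ k, c ≠ p i) :
    G.IsIndPath (fun i => if i = 0 then c else p (i - 1)) (k + 1) := by
  intro i j hi hj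
  dsimp only
  split_ifs with h1 h2 h2
  · exact ⟨by simp only [G.irrefl, false_iff]; omega, fun _ => by omega⟩
  · have := hne (j - 1) (by omega)
    rw [hc _ (by omega)]
    exact ⟨by omega, fun h => (this h).elim⟩
  · have := hne (i - 1) (by omega)
    rw [G.adj_comm, hc _ (by omega)]
    exact ⟨by omega, fun h => (this h.symm).elim⟩
  · have := hp (i - 1) (j - 1) (by omega) (by omega)
    exact ⟨by rw [this.1]; omega, fun h => by have := this.2 h; omega⟩

theorem Reachable.exists_isIndPath {w v : V} (h : G.Reachable w v) :
    ∃ (p : ℕ → V) (k : ℕ), p 0 = w ∧ p k = v ∧ G.IsIndPath p k := by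
  have key : ∀ k v, G.Reachable w v → G.dist w v = k → ∃ p : ℕ → V, p k = v ∧
      (∀ i ≤ k, G.Reachable w (p i) ∧ G.dist w (p i) = i) ∧ ∀ i < k, G.Adj (p i) (p (i + 1)) := by
    intro k
    induction k with
    | zero =>
      intro v hv hk
      refine ⟨fun _ => v, rfl, fun i hi => ?_, fun i hi => by omega⟩
      obtain rfl : i = 0 := by omega
      exact ⟨hv, hk⟩
    | succ k ih =>
      intro v hv hk
      obtain ⟨u, hu, hur, hud⟩ := hv.exists_adj_dist_eq hk
      obtain ⟨p, hp1, hp2, hp3⟩ := ih u hur hud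
      refine ⟨fun i => if i = k + 1 then v else p i, by simp, fun i hi => ?_, fun i hi => ?_⟩
      · by_cases h : i = k + 1
        · subst h; simpa using ⟨hv, hk⟩
        · simpa [h] using hp2 i (by omega)
      · by_cases h : i = k
        · subst h; simpa [hp1] using hu
        · have := hp3 i (by omega)
          dsimp only
          rw [if_neg (by omega), if_neg (by omega)]
          exact this
  obtain ⟨p, hp1, hp2, hp3⟩ := key _ v h rfl
  refine ⟨p, _, ?_, hp1, ?_⟩
  · have := hp2 0 (by omega)
    exact ((this.1.dist_eq_zero_iff).1 this.2).symm
  · intro i j hi hj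
    have h1 := hp2 i hi
    have h2 := hp2 j hj
    refine ⟨⟨fun hadj => ?_, ?_⟩, fun he => ?_⟩
    · have hne : i ≠ j := by rintro rfl; exact G.irrefl hadj
      have := hadj.diff_dist_adj (u := w)
      omega
    · rintro (rfl | rfl)
      · exact (hp3 j (by omega)).symm
      · exact hp3 i (by omega)
    · rw [he] at h1; omega

/-- In a connected hole-free graph, lower neighbours of two equal or adjacent vertices of the same
distance layer are equal or adjacent. -/
theorem Connected.adj_of_lower_neighbors (hconn : G.Connected) (hno : ¬ G.HasHole) {r : V} {k : ℕ}
    {x y w w' : V} (hx : G.dist r x = k + 1) (hy : G.dist r y = k + 1) (hxy : x = y ∨ G.Adj x y)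
    (hwx : G.Adj w x) (hwy : G.Adj w' y) (hw : G.dist r w = k) (hw' : G.dist r w' = k)
    (hne : w ≠ w') : G.Adj w w' := by
  by_contra hn
  have hd := fun x y => hconn.dist_le_succ_of_adj r (x := x) (y := y)
  have par := fun k x => (hconn r x).exists_adj_dist_eq (k := k)
  obtain _ | m := k
  · rw [hconn.dist_eq_zero_iff] at hw hw'
    exact hne (hw.symm.trans hw')
  let s : Set V := {z | z = w ∨ z = w' ∨ G.dist r z ≤ m}
  have hrs : r ∈ s := Or.inr (Or.inr (by simp))
  have low : ∀ j z (hz : z ∈ s), G.dist r z = j → j ≤ m →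
      (G.induce s).Reachable ⟨r, hrs⟩ ⟨z, hz⟩ := by
    intro j
    induction j with
    | zero =>
      intro z hz h _
      obtain rfl := hconn.dist_eq_zero_iff.1 h
      exact Reachable.refl _
    | succ j ih =>
      intro z hz h hj
      obtain ⟨p, hp, -, hpd⟩ := par j z h
      have hps : p ∈ s := Or.inr (Or.inr (by omega))
      have hadj : (G.induce s).Adj ⟨p, hps⟩ ⟨z, hz⟩ := hp
      exact (ih p hps hpd (by omega)).trans hadj.reachable
  have top : ∀ z (hz : z ∈ s), G.dist r z = m + 1 → (G.induce s).Reachable ⟨r, hrs⟩ ⟨z, hz⟩ := by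
    intro z hz h
    obtain ⟨p, hp, -, hpd⟩ := par m z h
    have hps : p ∈ s := Or.inr (Or.inr (by omega))
    have hadj : (G.induce s).Adj ⟨p, hps⟩ ⟨z, hz⟩ := hp
    exact (low _ p hps rfl (by omega)).trans hadj.reachable
  have hws : w ∈ s := Or.inl rfl
  have hws' : w' ∈ s := Or.inr (Or.inl rfl)
  obtain ⟨p, l, h0, hl, hp⟩ := ((top w hws hw).symm.trans (top w' hws' hw')).exists_isIndPath
  have hq : G.IsIndPath (fun i => (p i : V)) l := fun i j hi hj =>
    ⟨(hp i j hi hj).1, fun h => (hp i j hi hj).2 (Subtype.ext h)⟩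
  have e0 : (p 0 : V) = w := by rw [h0]
  have el : (p l : V) = w' := by rw [hl]
  have l0 : l ≠ 0 := by
    rintro rfl
    exact hne (e0.symm.trans el)
  have l1 : l ≠ 1 := by
    rintro rfl
    exact hn (by rw [← e0, ← el]; exact ((hq 0 1 (by omega) le_rfl).1).2 (Or.inr rfl))
  have inner : ∀ i, 0 < i → i < l → G.dist r (p i) ≤ m := by
    intro i hi hil
    rcases (p i).2 with h | h | h
    · have := (hq i 0 hil.le (by omega)).2 (h.trans e0.symm)
      omega
    · have := (hq i l hil.le le_rfl).2 (h.trans el.symm)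
      omega
    · exact h
  have dist_le : ∀ i ≤ l, G.dist r (p i) ≤ m + 1 := by
    intro i hi
    by_cases h : i = 0
    · subst h; rw [e0]; omega
    by_cases h' : i = l
    · subst h'; rw [el]; omega
    exact (inner i (by omega) (by omega)).trans (by omega)
  have ne : ∀ z, G.dist r z = m + 2 → ∀ i ≤ l, z ≠ p i := by
    rintro z hz i hi rfl
    have := dist_le i hi
    omega
  have nadj : ∀ z, G.dist r z = m + 2 → ∀ i, 0 < i → i < l → ¬ G.Adj z (p i) := by
    intro z hz i hi hil h
    have h1 := hd _ _ h.symm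
    have h2 := inner i hi hil
    omega
  have adj_iff : ∀ z, G.dist r z = m + 2 → ∀ i ≤ l,
      (G.Adj z (p i) ↔ (i = 0 ∧ G.Adj z w) ∨ (i = l ∧ G.Adj z w')) := by
    intro z hz i hi
    constructor
    · intro h
      by_cases h0 : i = 0
      · subst h0; rw [e0] at h; exact Or.inl ⟨rfl, h⟩
      by_cases hl : i = l
      · subst hl; rw [el] at h; exact Or.inr ⟨rfl, h⟩
      exact (nadj z hz i (by omega) (by omega) h).elim
    · rintro (⟨rfl, h⟩ | ⟨rfl, h⟩)
      · rwa [e0]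
      · rwa [el]
  have close : ∀ z, G.dist r z = m + 2 → G.Adj z w → G.Adj z w' → False := by
    intro z hz h1 h2
    obtain ⟨f, hf⟩ := hq.exists_isHoleOn (by omega) (c := z)
      (fun i hi => by rw [adj_iff z hz i hi]; simp [h1, h2]) (ne z hz)
    exact hno ⟨_, f, hf⟩
  have hxw' : ¬ G.Adj x w' := close x hx hwx.symm
  have hyw : ¬ G.Adj y w := fun h => close y hy h hwy.symm
  have hxy' : G.Adj x y := hxy.resolve_left (by rintro rfl; exact hyw hwx.symm)
  have hq' := hq.cons (c := x)
    (fun i hi => by rw [adj_iff x hx i hi]; simp [hwx.symm, hxw']) (ne x hx)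
  obtain ⟨f, hf⟩ := hq'.exists_isHoleOn (by omega) (c := y)
    (fun i hi => by
      split_ifs with h
      · simp [h, hxy'.symm]
      · rw [adj_iff y hy (i - 1) (by omega)]
        simp only [hyw, hwy.symm, and_false, and_true, false_or]
        omega)
    (fun i hi => by
      split_ifs with h
      · exact hxy'.symm.ne
      · exact ne y hy (i - 1) (by omega))
  exact hno ⟨_, f, hf⟩

/-- Two neighbours of a simplicial vertex `a` that each have a private outer neighbour have no
common neighbour outside the closed neighbourhood of `a`. -/
theorem ForbFree.no_common_neighbor (hG : G.ForbFree) {a u v x y w : V}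
    (hcl : ∀ u v, G.Adj a u → G.Adj a v → u ≠ v → G.Adj u v) (hu : G.Adj a u) (hv : G.Adj a v)
    (hx : G.Adj u x) (hy : G.Adj v y) (huy : ¬ G.Adj u y) (hvx : ¬ G.Adj v x) (huy' : u ≠ y)
    (hvx' : v ≠ x) (hwu : G.Adj w u) (hwv : G.Adj w v) (hwa : ¬ G.Adj w a) (hwa' : w ≠ a) :
    False := by
  have huv : u ≠ v := by rintro rfl; exact hvx hx
  have huv' := hcl u v hu hv huv
  have hxa : x ≠ a := by rintro rfl; exact hvx hv.symm
  have hya : y ≠ a := by rintro rfl; exact huy hu.symm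
  have hax : ¬ G.Adj a x := fun h => hvx (hcl v x hv h hvx')
  have hay : ¬ G.Adj a y := fun h => huy (hcl u y hu h huy')
  have hwx : w ≠ x := by rintro rfl; exact hvx hwv.symm
  have hwy : w ≠ y := by rintro rfl; exact huy hwu.symm
  have hxy : ¬ G.Adj x y := fun h =>
    hG.c4 u x y v hx h hy.symm huv'.symm huy' hvx'.symm huy fun h => hvx h.symm
  have hwx1 : G.Adj w x := by
    by_contra h
    exact hG.claw u a w x hu.symm hwu.symm hx hwa'.symm hxa.symm hwx (fun h => hwa h.symm) hax h
  have hwy1 : G.Adj w y := by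
    by_contra h
    exact hG.claw v a w y hv.symm hwv.symm hy hwa'.symm hya.symm hwy (fun h => hwa h.symm) hay h
  exact hG.tent u v w y x a huv' hwu.symm hwv.symm huy hvx hwa hx hu.symm hy hv.symm hwy1 hwx1
    (fun h => hxy h.symm) (fun h => hay h.symm) (fun h => hax h.symm)

theorem ForbFree.exists_isNestedEnd [Finite V] (hG : G.ForbFree) (hconn : G.Connected)
    (hno : ¬ G.HasHole) : ∃ a, G.IsNestedEnd a := by
  by_cases hcomp : ∀ x y, x ≠ y → G.Adj x y
  · obtain ⟨a⟩ := hconn.nonempty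
    exact ⟨a, fun u v _ _ h => hcomp u v h, fun u v x y _ _ _ _ h _ h' _ => h (hcomp u y h')⟩
  push Not at hcomp
  obtain ⟨r, s, hrs, hrs'⟩ := hcomp
  have hd := fun x y => hconn.dist_le_succ_of_adj r (x := x) (y := y)
  have par := fun k x => (hconn r x).exists_adj_dist_eq (k := k)
  have : Nonempty V := ⟨r⟩
  obtain ⟨b, hb⟩ := Finite.exists_max fun x => G.dist r x
  obtain ⟨e, he⟩ : ∃ e, G.dist r b = e + 2 := by
    refine ⟨G.dist r b - 2, ?_⟩
    have h1 := hb s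
    have h2 : G.dist r s ≠ 0 := fun h => hrs (hconn.dist_eq_zero_iff.1 h)
    have h3 : G.dist r s ≠ 1 := fun h => hrs' (dist_eq_one_iff_adj.1 h)
    omega
  obtain ⟨a, ha, hmin⟩ := Set.exists_min_image {x | G.dist r x = e + 2}
    (fun x => {w | G.Adj w x ∧ G.dist r w = e + 1}.ncard) (Set.toFinite _) ⟨b, he⟩
  simp only [Set.mem_ofPred_eq] at ha hmin
  rw [he] at hb
  have hlow := fun k x y w w' => hconn.adj_of_lower_neighbors hno (r := r) (k := k) (x := x)
    (y := y) (w := w) (w' := w')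
  have hup : ∀ x, G.dist r x = e + 2 → G.Adj a x → ∀ w, G.Adj w a → G.dist r w = e + 1 →
      G.Adj w x := by
    intro x hx hax w hwa hw
    by_contra hwx
    have hlt : {w | G.Adj w x ∧ G.dist r w = e + 1} ⊂ {w | G.Adj w a ∧ G.dist r w = e + 1} := by
      refine ⟨?_, fun h => hwx (h ⟨hwa, hw⟩).1⟩
      rintro z ⟨hzx, hz⟩
      refine ⟨?_, hz⟩
      by_contra hza
      have hwz : w ≠ z := by rintro rfl; exact hwx hzx
      exact hG.c4 a w z x hwa.symm (hlow _ a x w z ha hx (Or.inr hax) hwa hzx hw hz hwz) hzx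
        hax.symm (by rintro rfl; omega) (by rintro rfl; omega) (fun h => hza h.symm) hwx
    have := Set.ncard_lt_ncard hlt (Set.toFinite _)
    have := hmin x hx
    omega
  have lay : ∀ x, G.Adj a x → G.dist r x = e + 1 ∨ G.dist r x = e + 2 := by
    intro x h
    have h1 := hd _ _ h.symm
    have h2 := hb x
    omega
  have hcl : ∀ u v, G.Adj a u → G.Adj a v → u ≠ v → G.Adj u v := by
    intro u v hu hv huv
    rcases lay u hu with h1 | h1 <;> rcases lay v hv with h2 | h2
    · exact hlow _ a a u v ha ha (Or.inl rfl) hu.symm hv.symm h1 h2 huv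
    · exact hup v h2 hv u hu.symm h1
    · exact (hup u h1 hu v hv.symm h2).symm
    · obtain ⟨w, hw, -, hwd⟩ := par _ a ha
      obtain ⟨p, hp, -, hpd⟩ := par _ w hwd
      by_contra hn
      exact hG.claw w p u v hp.symm (hup u h1 hu w hw hwd) (hup v h2 hv w hw hwd)
        (by rintro rfl; omega) (by rintro rfl; omega) huv
        (fun h => by have := hd _ _ h; omega) (fun h => by have := hd _ _ h; omega) hn
  have mix : ∀ u v x y, G.dist r u = e + 1 → G.dist r v = e + 2 → G.Adj a u → G.Adj a v →
      G.Adj u x → G.Adj v y → ¬ G.Adj u y → ¬ G.Adj v x → u ≠ y → v ≠ x → False := by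
    intro u v x y hud hvd hu hv hx hy huy hvx huy' hvx'
    have huv : u ≠ v := by rintro rfl; exact hvx hx
    have huv' := hcl u v hu hv huv
    have hyd : G.dist r y = e + 1 ∨ G.dist r y = e + 2 := by
      have h1 := hd _ _ hy.symm
      have h2 := hb y
      omega
    rcases hyd with hyd | hyd
    · exact huy (hlow _ v v u y hvd hvd (Or.inl rfl) huv' hy.symm hud hyd huy')
    · obtain ⟨w, hw, -, hwd⟩ := par _ y hyd
      have hwu : w ≠ u := by rintro rfl; exact huy hw
      have hwu' := hlow _ y v w u hyd hvd (Or.inr hy.symm) hw huv' hwd hud hwu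
      have hwv : G.Adj w v := by
        by_contra h
        exact hG.c4 w y v u hw hy.symm huv'.symm hwu'.symm (by rintro rfl; omega) huy'.symm h
          fun h => huy h.symm
      have hay : ¬ G.Adj a y := fun h => huy (hcl u y hu h huy')
      have hay' : a ≠ y := by rintro rfl; exact huy hu.symm
      have hwa : ¬ G.Adj w a := by
        intro h
        obtain ⟨p, hp, -, hpd⟩ := par _ w hwd
        exact hG.claw w p a y hp.symm h hw (by rintro rfl; omega) (by rintro rfl; omega) hay'
          (fun h => by have := hd _ _ h; omega) (fun h => by have := hd _ _ h; omega) hay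
      exact hG.no_common_neighbor hcl hu hv hx hy huy hvx huy' hvx' hwu' hwv hwa
        (by rintro rfl; omega)
  refine ⟨a, hcl, ?_⟩
  intro u v x y hu hv hx hy huy hvx huy' hvx'
  have huv : u ≠ v := by rintro rfl; exact hvx hx
  have huv' := hcl u v hu hv huv
  rcases lay u hu with hud | hud <;> rcases lay v hv with hvd | hvd
  · obtain ⟨w, hwu, hwv, hwd⟩ : ∃ w, G.Adj w u ∧ G.Adj w v ∧ G.dist r w = e := by
      obtain ⟨p, hp, -, hpd⟩ := par _ u hud
      obtain ⟨q, hq, -, hqd⟩ := par _ v hvd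
      by_cases hpv : G.Adj p v
      · exact ⟨p, hp, hpv, hpd⟩
      by_cases hqu : G.Adj q u
      · exact ⟨q, hqu, hq, hqd⟩
      have hpq : p ≠ q := by rintro rfl; exact hpv hq
      have hpq' := hlow _ u v p q hud hvd (Or.inr huv') hp hq hpd hqd hpq
      exact (hG.c4 p q v u hpq' hq huv'.symm hp.symm (by rintro rfl; omega) (by rintro rfl; omega)
        hpv hqu).elim
    exact hG.no_common_neighbor hcl hu hv hx hy huy hvx huy' hvx' hwu hwv
      (fun h => by have := hd _ _ h; omega) (by rintro rfl; omega)
  · exact mix u v x y hud hvd hu hv hx hy huy hvx huy' hvx'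
  · exact mix v u y x hvd hud hv hu hy hx hvx huy hvx' huy'
  · obtain ⟨w, hw, -, hwd⟩ := par _ a ha
    obtain ⟨p, hp, -, hpd⟩ := par _ w hwd
    have hwu := hup u hud hu w hw hwd
    have hwv := hup v hvd hv w hw hwd
    have hpu : ¬ G.Adj u p := fun h => by have := hd _ _ h.symm; omega
    have hpv : ¬ G.Adj v p := fun h => by have := hd _ _ h.symm; omega
    by_cases hwx : G.Adj w x
    · by_cases hwy : G.Adj w y
      · exact hG.claw w a x y hw hwx hwy (by rintro rfl; exact hvx hv.symm)
          (by rintro rfl; exact huy hu.symm) (by rintro rfl; exact hvx hy)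
          (fun h => hvx (hcl v x hv h hvx')) (fun h => huy (hcl u y hu h huy'))
          fun h => hG.c4 u x y v hx h hy.symm huv'.symm huy' hvx'.symm huy fun h => hvx h.symm
      · exact mix w v p y hwd hvd hw.symm hv hp.symm hy hwy hpv
          (by rintro rfl; exact huy hwu.symm) (by rintro rfl; omega)
    · exact mix w u p x hwd hud hw.symm hu hp.symm hx hwx hpu
        (by rintro rfl; exact hvx hwv.symm) (by rintro rfl; omega)

end SimpleGraph

namespace SimpleGraph

variable {V : Type*} {G : SimpleGraph V} {n : ℕ} {f : ZMod n → V}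

theorem AdjEq.symm {x y : V} (h : G.AdjEq x y) : G.AdjEq y x := h.imp Eq.symm fun h => h.symm

theorem AdjEq.adj {x y : V} (h : G.AdjEq x y) (hne : x ≠ y) : G.Adj x y := h.resolve_left hne

/-- A shortest hole. -/
structure IsMinHole (G : SimpleGraph V) (n : ℕ) (f : ZMod n → V) : Prop where
  hole : G.IsHoleOn n f
  five_le : 5 ≤ n
  min : ∀ m < n, ∀ g, ¬ G.IsHoleOn m g

/-- The neighbours of `x` on the hole are `f i`, `f (i + 1)`, and possibly `f (i - 1)`. -/
structure SitsAt (G : SimpleGraph V) (f : ZMod n → V) (x : V) (i : ZMod n) : Prop where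
  adj_self : G.AdjEq x (f i)
  adj_succ : G.AdjEq x (f (i + 1))
  near : ∀ j, G.AdjEq x (f j) → j = i - 1 ∨ j = i ∨ j = i + 1

theorem ForbFree.exists_isMinHole (hG : G.ForbFree) (h : G.HasHole) :
    ∃ (n : ℕ) (f : ZMod n → V), G.IsMinHole n f := by
  classical
  obtain ⟨f, hf⟩ := Nat.find_spec h
  refine ⟨_, f, hf, ?_, fun m hm g hg => Nat.find_min h hm ⟨g, hg⟩⟩
  have h4 := hf.1
  generalize Nat.find h = n at f hf h4
  rcases h4.eq_or_lt with rfl | h5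
  · have hinj := hf.2.1
    have hadj := hf.2.2
    exact (hG.c4 (f 0) (f 1) (f 2) (f 3) ((hadj _ _).2 (by decide)) ((hadj _ _).2 (by decide))
      ((hadj _ _).2 (by decide)) ((hadj _ _).2 (by decide)) (hinj.ne (by decide))
      (hinj.ne (by decide)) (fun h => absurd ((hadj _ _).1 h) (by decide))
      (fun h => absurd ((hadj _ _).1 h) (by decide))).elim
  · exact h5

namespace IsMinHole

theorem adj_iff (hM : G.IsMinHole n f) (i j : ZMod n) :
    G.Adj (f i) (f j) ↔ i = j + 1 ∨ j = i + 1 := hM.hole.2.2 i j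

theorem adjEq_iff (hM : G.IsMinHole n f) (i j : ZMod n) :
    G.AdjEq (f i) (f j) ↔ i = j ∨ i = j + 1 ∨ j = i + 1 := by
  rw [AdjEq, hM.adj_iff, hM.hole.2.1.eq_iff]

theorem adj_succ (hM : G.IsMinHole n f) (i : ZMod n) : G.Adj (f i) (f (i + 1)) :=
  (hM.adj_iff _ _).2 (Or.inr rfl)

theorem far (hM : G.IsMinHole n f) {i j : ZMod n}
    (h : j = i + 2 ∨ j = i + 3 ∨ i = j + 2 ∨ i = j + 3) : f i ≠ f j ∧ ¬ G.Adj (f i) (f j) := by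
  obtain ⟨z1, z2, z3, z4⟩ := ZMod.small_ne_zero hM.five_le
  rw [hM.hole.2.1.ne_iff, hM.adj_iff]
  refine ⟨?_, ?_⟩
  · rintro rfl
    rcases h with h | h | h | h
    · exact z2 (by linear_combination -h)
    · exact z3 (by linear_combination -h)
    · exact z2 (by linear_combination -h)
    · exact z3 (by linear_combination -h)
  · rintro (rfl | rfl) <;> rcases h with h | h | h | h
    · exact z3 (by linear_combination -h)
    · exact z4 (by linear_combination -h)
    · exact z1 (by linear_combination -h)
    · exact z2 (by linear_combination -h)
    · exact z1 (by linear_combination -h)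
    · exact z2 (by linear_combination -h)
    · exact z3 (by linear_combination -h)
    · exact z4 (by linear_combination -h)

theorem no_run_of_four (hM : G.IsMinHole n f) (hG : G.ForbFree) {x : V} {i : ZMod n}
    (h0 : G.AdjEq x (f i)) (h1 : G.AdjEq x (f (i + 1))) (h2 : G.AdjEq x (f (i + 2)))
    (h3 : G.AdjEq x (f (i + 3))) (hn : ¬ G.AdjEq x (f (i - 1))) : False := by
  obtain ⟨z1, z2, z3, z4⟩ := ZMod.small_ne_zero hM.five_le
  have h5 := hM.five_le
  have hx : ∀ j, x ≠ f j := by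
    rintro j rfl
    simp only [hM.adjEq_iff] at h0 h1 h2 h3 hn
    grind
  have key : ∀ j, G.Adj x (f j) → j = i ∨ j = i + 1 ∨ j = i + 2 ∨ j = i + 3 := by
    intro j hj
    by_contra hc
    push Not at hc
    have hj1 : j ≠ i - 1 := by rintro rfl; exact hn (Or.inr hj)
    exact hG.claw x (f i) (f (i + 2)) (f j) (h0.adj (hx _)) (h2.adj (hx _)) hj
      (hM.far (by grind)).1 (hM.hole.2.1.ne (by grind)) (hM.hole.2.1.ne (by grind))
      (hM.far (by grind)).2 (by rw [hM.adj_iff]; grind) (by rw [hM.adj_iff]; grind)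
  have hpath : G.IsIndPath (fun t : ℕ => f (i + 3 + t)) (n - 3) := by
    intro s t hs ht
    constructor
    · rw [hM.adj_iff]
      refine or_congr ⟨fun h => ?_, ?_⟩ ⟨fun h => ?_, ?_⟩
      · exact natCast_inj_of_lt (m := n) (by omega) (by omega)
          (by push_cast; linear_combination h)
      · rintro rfl; push_cast; ring
      · exact natCast_inj_of_lt (m := n) (by omega) (by omega)
          (by push_cast; linear_combination h)
      · rintro rfl; push_cast; ring
    · intro h
      exact natCast_inj_of_lt (m := n) (by omega) (by omega)
        (by linear_combination hM.hole.2.1 h)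
  obtain ⟨g, hg⟩ := hpath.exists_isHoleOn (by omega) (c := x) (fun t ht => by
    constructor
    · intro h
      have dvd : ∀ s : ℕ, ((t + s : ℕ) : ZMod n) = 0 → 0 < t + s → n ≤ t + s := fun s h hpos =>
        Nat.le_of_dvd hpos ((ZMod.natCast_eq_zero_iff _ _).1 h)
      rcases key _ h with h | h | h | h
      · have := dvd 3 (by push_cast; linear_combination h) (by omega)
        omega
      · have := dvd 2 (by push_cast; linear_combination h) (by omega)
        omega
      · have := dvd 1 (by push_cast; linear_combination h) (by omega)
        omega
      · by_contra hc
        have := dvd 0 (by push_cast; linear_combination h) (by omega)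
        omega
    · rintro (rfl | rfl)
      · simpa using h3.adj (hx _)
      · have : i + 3 + ((n - 3 : ℕ) : ZMod n) = i := by
          have : ((n - 3 + 3 : ℕ) : ZMod n) = 0 := by
            rw [Nat.sub_add_cancel (by omega)]; exact ZMod.natCast_self n
          push_cast at this
          linear_combination this
        rw [this]
        exact h0.adj (hx _)) (fun t _ => hx _)
  exact hM.min _ (by omega) g hg

theorem sitsAt_self (hM : G.IsMinHole n f) (i : ZMod n) : G.SitsAt f (f i) i where
  adj_self := Or.inl rfl
  adj_succ := Or.inr (hM.adj_succ i)
  near j h := by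
    rw [hM.adjEq_iff] at h
    grind

theorem sitsAt_unique (hM : G.IsMinHole n f) {x : V} {i j : ZMod n} (hi : G.SitsAt f x i)
    (hj : G.SitsAt f x j) : i = j := by
  obtain ⟨z1, z2, z3, z4⟩ := ZMod.small_ne_zero hM.five_le
  have h1 := hj.near _ hi.adj_self
  have h2 := hj.near _ hi.adj_succ
  have h3 := hi.near _ hj.adj_self
  have h4 := hi.near _ hj.adj_succ
  grind

theorem forall_or_sitsAt (hM : G.IsMinHole n f) (hG : G.ForbFree) {x : V} {k : ZMod n}
    (hk : G.AdjEq x (f k)) : (∀ j, G.AdjEq x (f j)) ∨ ∃ i, G.SitsAt f x i := by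
  obtain ⟨z1, z2, z3, z4⟩ := ZMod.small_ne_zero hM.five_le
  have hinj := hM.hole.2.1
  by_cases hx : ∃ j, x = f j
  · obtain ⟨j, rfl⟩ := hx
    exact Or.inr ⟨j, hM.sitsAt_self j⟩
  push Not at hx
  have hA : ∀ j, G.AdjEq x (f j) ↔ G.Adj x (f j) := fun j => ⟨fun h => h.adj (hx j), Or.inr⟩
  simp only [hA] at hk
  refine or_iff_not_imp_left.2 fun hall => ?_
  obtain ⟨i, hi, hi'⟩ : ∃ i, G.Adj x (f i) ∧ ¬ G.Adj x (f (i - 1)) := by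
    by_contra hc
    push Not at hc
    have step : ∀ t : ℕ, G.Adj x (f (k - t)) := by
      intro t
      induction t with
      | zero => simpa using hk
      | succ t ih =>
        have := hc _ ih
        rwa [show k - (t : ZMod n) - 1 = k - ((t + 1 : ℕ) : ZMod n) by push_cast; ring] at this
    have : NeZero n := ⟨by have := hM.five_le; omega⟩
    refine hall fun j => Or.inr ?_
    have := step (k - j).val
    rwa [ZMod.natCast_zmod_val, sub_sub_cancel] at this
  have hi1 : G.Adj x (f (i + 1)) := by
    by_contra hc
    exact hG.claw (f i) x (f (i - 1)) (f (i + 1)) hi.symm ((hM.adj_iff _ _).2 (by grind))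
      (hM.adj_succ i) (hx _) (hx _) (hM.far (by grind)).1 hi' hc (hM.far (by grind)).2
  by_cases hi2 : G.Adj x (f (i + 2))
  · have hi3 : ¬ G.Adj x (f (i + 3)) := fun h => hM.no_run_of_four hG ((hA _).2 hi) ((hA _).2 hi1)
      ((hA _).2 hi2) ((hA _).2 h) (by rwa [hA])
    refine ⟨i + 1, (hA _).2 hi1, (hA _).2 (by convert hi2 using 2; ring), fun j hj => ?_⟩
    rw [hA] at hj
    by_contra hc
    push Not at hc
    have hj1 : j ≠ i - 1 := by rintro rfl; exact hi' hj
    have hj2 : j ≠ i + 3 := by rintro rfl; exact hi3 hj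
    exact hG.claw x (f i) (f (i + 2)) (f j) hi hi2 hj
      (hM.far (by grind)).1 (hinj.ne (by grind)) (hinj.ne (by grind))
      (hM.far (by grind)).2 (by rw [hM.adj_iff]; grind) (by rw [hM.adj_iff]; grind)
  · refine ⟨i, (hA _).2 hi, (hA _).2 hi1, fun j hj => ?_⟩
    rw [hA] at hj
    by_contra hc
    push Not at hc
    have hj1 : j ≠ i + 2 := by rintro rfl; exact hi2 hj
    have hj2 : j ≠ i + 3 := by
      rintro rfl
      exact hG.c4 x (f (i + 1)) (f (i + 2)) (f (i + 3)) hi1 (by rw [hM.adj_iff]; grind)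
        (by rw [hM.adj_iff]; grind) hj.symm (hx _) (hM.far (by grind)).1 hi2
        (hM.far (by grind)).2
    have hj3 : j ≠ i - 2 := by
      rintro rfl
      exact hG.c4 x (f i) (f (i - 1)) (f (i - 2)) hi (by rw [hM.adj_iff]; grind)
        (by rw [hM.adj_iff]; grind) hj.symm (hx _) (hM.far (by grind)).1 hi'
        (hM.far (by grind)).2
    exact hG.net x (f i) (f (i + 1)) (f j) (f (i - 1)) (f (i + 2)) hi hi1 (hM.adj_succ i) hj
      ((hM.adj_iff _ _).2 (by grind)) ((hM.adj_iff _ _).2 (by grind)) hi' hi2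
      (by rw [hM.adj_iff]; grind) (hM.far (by grind)).2 (by rw [hM.adj_iff]; grind)
      (hM.far (by grind)).2 (by rw [hM.adj_iff]; grind) (by rw [hM.adj_iff]; grind)
      (hM.far (by grind)).2

end IsMinHole

namespace SitsAt

variable {x y : V} {i j : ZMod n}

theorem not_adjEq (s : G.SitsAt f x i) (hM : G.IsMinHole n f)
    (h : j = i + 2 ∨ j = i + 3 ∨ i = j + 2 ∨ i = j + 3) : ¬ G.AdjEq x (f j) := by
  intro hx
  have hfar := hM.far h
  rcases s.near j hx with rfl | rfl | rfl
  · exact hfar.2 ((hM.adj_iff _ _).2 (by grind))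
  · exact hfar.1 rfl
  · exact hfar.2 (hM.adj_succ i)

theorem adj_right (s : G.SitsAt f x i) (hM : G.IsMinHole n f) : G.Adj x (f (i + 1)) := by
  refine s.adj_succ.adj ?_
  rintro rfl
  exact s.not_adjEq hM (j := i + 2) (by simp) (Or.inr ((hM.adj_iff _ _).2 (by grind)))

theorem adj_mid (s : G.SitsAt f x i) (hM : G.IsMinHole n f) (h : ¬ G.AdjEq x (f (i - 1))) :
    G.Adj x (f i) := by
  refine s.adj_self.adj ?_
  rintro rfl
  exact h (Or.inr ((hM.adj_iff _ _).2 (by grind)))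

theorem adj_left (s : G.SitsAt f x i) (hM : G.IsMinHole n f) (h : G.AdjEq x (f (i - 1))) :
    G.Adj x (f (i - 1)) := by
  refine h.adj ?_
  rintro rfl
  exact (hM.far (by grind)).2 (s.adj_right hM)

theorem adj_of_eq (s : G.SitsAt f x i) (t : G.SitsAt f y i) (hM : G.IsMinHole n f)
    (hG : G.ForbFree) (hne : x ≠ y) : G.Adj x y := by
  by_contra hn
  have h2 : G.Adj (f (i + 1)) (f (i + 2)) := (hM.adj_iff _ _).2 (by grind)
  have hx := s.not_adjEq hM (j := i + 2) (by simp)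
  have hy := t.not_adjEq hM (j := i + 2) (by simp)
  exact hG.claw (f (i + 1)) x y (f (i + 2)) (s.adj_right hM).symm (t.adj_right hM).symm h2 hne
    (fun h => hx (Or.inl h)) (fun h => hy (Or.inl h)) hn (fun h => hx (Or.inr h))
    fun h => hy (Or.inr h)

end SitsAt

namespace IsMinHole

theorem not_forall_adjEq (hM : G.IsMinHole n f) (k : ZMod n) : ¬ ∀ j, G.AdjEq (f k) (f j) :=
  fun h => (hM.sitsAt_self k).not_adjEq hM (j := k + 2) (by simp) (h _)

theorem adj_of_forall (hM : G.IsMinHole n f) {u : V} (hu : ∀ j, G.AdjEq u (f j)) (j : ZMod n) :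
    G.Adj u (f j) := by
  refine (hu j).adj ?_
  rintro rfl
  exact hM.not_forall_adjEq j hu

theorem exists_adjEq_of_adj (hM : G.IsMinHole n f) (hG : G.ForbFree) {x y : V} {k : ZMod n}
    (hx : G.AdjEq x (f k)) (hxy : G.Adj x y) : ∃ j, G.AdjEq y (f j) := by
  by_contra hc
  push Not at hc
  have hyn : ∀ j, ¬ G.Adj y (f j) := fun j h => hc j (Or.inr h)
  have hye : ∀ j, f j ≠ y := fun j h => hc j (Or.inl h.symm)
  have hxf : ∀ j, x ≠ f j := by
    rintro j rfl
    exact hyn j hxy.symm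
  rcases hM.forall_or_sitsAt hG hx with h | ⟨i, s⟩
  · exact hG.claw x (f 0) (f 2) y ((h _).adj (hxf _)) ((h _).adj (hxf _)) hxy
      (hM.far (by grind)).1 (hye _) (hye _) (hM.far (by grind)).2 (fun h => hyn _ h.symm)
      fun h => hyn _ h.symm
  · by_cases h : G.AdjEq x (f (i - 1))
    · exact hG.claw x (f (i - 1)) (f (i + 1)) y (h.adj (hxf _)) (s.adj_right hM) hxy
        (hM.far (by grind)).1 (hye _) (hye _) (hM.far (by grind)).2 (fun h => hyn _ h.symm)
        fun h => hyn _ h.symm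
    · exact hG.net x (f i) (f (i + 1)) y (f (i - 1)) (f (i + 2)) (s.adj_mid hM h) (s.adj_right hM)
        (hM.adj_succ i) hxy ((hM.adj_iff _ _).2 (by grind)) ((hM.adj_iff _ _).2 (by grind))
        (fun h' => h (Or.inr h')) (fun h' => s.not_adjEq hM (j := i + 2) (by simp) (Or.inr h'))
        (fun h => hyn _ h.symm) (hM.far (by grind)).2 (fun h => hyn _ h.symm)
        (hM.far (by grind)).2 (hyn _) (hyn _) (hM.far (by grind)).2

theorem exists_adjEq (hM : G.IsMinHole n f) (hG : G.ForbFree) (hconn : G.Connected) (x : V) :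
    ∃ j, G.AdjEq x (f j) := by
  have key : ∀ u v, G.Walk u v → (∃ j, G.AdjEq v (f j)) → ∃ j, G.AdjEq u (f j) := by
    intro u v p
    induction p with
    | nil => exact id
    | cons h _ ih =>
      intro hv
      obtain ⟨j, hj⟩ := ih hv
      exact hM.exists_adjEq_of_adj hG hj h.symm
  obtain ⟨p⟩ := hconn x (f 0)
  exact key _ _ p ⟨0, Or.inl rfl⟩

theorem update (hM : G.IsMinHole n f) {x : V} {i : ZMod n} (s : G.SitsAt f x i)
    (h : G.AdjEq x (f (i - 1))) : G.IsMinHole n (Function.update f i x) := by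
  by_cases hx : ∃ k, x = f k
  · obtain ⟨k, rfl⟩ := hx
    obtain rfl := hM.sitsAt_unique s (hM.sitsAt_self k)
    rwa [Function.update_eq_self]
  push Not at hx
  have hadj : ∀ j, j ≠ i → (G.Adj x (f j) ↔ (i = j + 1 ∨ j = i + 1)) := by
    intro j hj
    constructor
    · intro h'
      have := s.near j (Or.inr h')
      grind
    · rintro (rfl | rfl)
      · rw [add_sub_cancel_right] at h
        exact h.adj (hx _)
      · exact s.adj_right hM
  refine ⟨⟨hM.hole.1, ?_, ?_⟩, hM.five_le, hM.min⟩
  · intro a b hab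
    by_cases ha : a = i <;> by_cases hb : b = i
    · rw [ha, hb]
    · subst ha
      rw [Function.update_self, Function.update_of_ne hb] at hab
      exact (hx _ hab).elim
    · subst hb
      rw [Function.update_self, Function.update_of_ne ha] at hab
      exact (hx _ hab.symm).elim
    · rw [Function.update_of_ne ha, Function.update_of_ne hb] at hab
      exact hM.hole.2.1 hab
  · intro a b
    by_cases ha : a = i <;> by_cases hb : b = i
    · subst ha hb
      have := (ZMod.small_ne_zero hM.five_le).1
      simp [this]
    · subst ha
      rw [Function.update_self, Function.update_of_ne hb, hadj b hb]
    · subst hb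
      rw [Function.update_self, Function.update_of_ne ha, G.adj_comm, hadj a ha, or_comm]
    · rw [Function.update_of_ne ha, Function.update_of_ne hb, hM.adj_iff]

theorem eq_or_of_adj (hM : G.IsMinHole n f) (hG : G.ForbFree) {x y : V} {i j : ZMod n}
    (s : G.SitsAt f x i) (t : G.SitsAt f y j) (hxy : G.Adj x y) :
    j = i ∨ j = i + 1 ∨ j = i + 2 ∨ i = j + 1 ∨ i = j + 2 := by
  by_contra hc
  push Not at hc
  have far_of_left : ∀ {x y : V} {i j : ZMod n}, G.SitsAt f x i → G.SitsAt f y j → G.Adj x y →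
      (j ≠ i ∧ j ≠ i + 1 ∧ j ≠ i + 2 ∧ i ≠ j + 1 ∧ i ≠ j + 2) → ¬ G.AdjEq x (f (i - 1)) := by
    intro x y i j s t hxy hc h
    have h1 : ¬ G.AdjEq y (f (i - 1)) := fun h => by have := t.near _ h; grind
    have h2 : ¬ G.AdjEq y (f (i + 1)) := fun h => by have := t.near _ h; grind
    exact hG.claw x (f (i - 1)) (f (i + 1)) y (s.adj_left hM h) (s.adj_right hM) hxy
      (hM.far (by grind)).1 (fun h => h1 (Or.inl h.symm)) (fun h => h2 (Or.inl h.symm))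
      (hM.far (by grind)).2 (fun h => h1 (Or.inr h.symm)) fun h => h2 (Or.inr h.symm)
  have hx := far_of_left s t hxy hc
  have hy := far_of_left t s hxy.symm (by tauto)
  have hyk : ∀ k, G.Adj y (f k) → k = j ∨ k = j + 1 := by
    intro k hk
    rcases t.near k (Or.inr hk) with rfl | h
    · exact (hy (Or.inr hk)).elim
    · exact h
  exact hG.net x (f i) (f (i + 1)) y (f (i - 1)) (f (i + 2)) (s.adj_mid hM hx) (s.adj_right hM)
    (hM.adj_succ i) hxy ((hM.adj_iff _ _).2 (by grind)) ((hM.adj_iff _ _).2 (by grind))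
    (fun h' => hx (Or.inr h')) (fun h' => s.not_adjEq hM (j := i + 2) (by simp) (Or.inr h'))
    (fun h => by have := hyk _ h.symm; grind) (hM.far (by grind)).2
    (fun h => by have := hyk _ h.symm; grind) (hM.far (by grind)).2
    (fun h => by have := hyk _ h; grind) (fun h => by have := hyk _ h; grind)
    (hM.far (by grind)).2

theorem not_adj_of_two_apart (hM : G.IsMinHole n f) (hG : G.ForbFree) {x y : V} {i : ZMod n}
    (s : G.SitsAt f x i) (t : G.SitsAt f y (i + 2)) (hx : G.AdjEq x (f (i - 1)))
    (hy : G.AdjEq y (f (i + 1))) : ¬ G.Adj x y := by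
  intro hxy
  obtain ⟨z1, z2, z3, z4⟩ := ZMod.small_ne_zero hM.five_le
  have hM' := hM.update t (by convert hy using 2; ring)
  have hupd : ∀ k, k ≠ i + 2 → Function.update f (i + 2) y k = f k := fun k hk =>
    Function.update_of_ne hk _ _
  refine hM'.no_run_of_four hG (x := x) (i := i - 1) ?_ ?_ ?_ ?_ ?_
  · rw [hupd _ fun h => z3 (by linear_combination -h)]
    exact hx
  · rw [sub_add_cancel, hupd _ fun h => z2 (by linear_combination -h)]
    exact s.adj_self
  · rw [show i - 1 + 2 = i + 1 by ring, hupd _ fun h => z1 (by linear_combination -h)]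
    exact s.adj_succ
  · rw [show i - 1 + 3 = i + 2 by ring, Function.update_self]
    exact Or.inr hxy
  · rw [hupd _ fun h => z4 (by linear_combination -h)]
    exact s.not_adjEq hM (by grind)

theorem shift_two_of_adj (hM : G.IsMinHole n f) (hG : G.ForbFree) {x y : V} {i : ZMod n}
    (s : G.SitsAt f x i) (t : G.SitsAt f y (i + 2)) (hxy : G.Adj x y) :
    ¬ G.AdjEq x (f (i - 1)) ∧ G.AdjEq y (f (i + 1)) := by
  have e1 : i + 2 - 1 = i + 1 := by ring
  by_cases hy : G.AdjEq y (f (i + 1))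
  · exact ⟨fun hx => hM.not_adj_of_two_apart hG s t hx hy hxy, hy⟩
  have h2 := s.not_adjEq hM (j := i + 2) (by simp)
  by_cases hx : G.AdjEq x (f (i - 1))
  · have h1 := t.not_adjEq hM (j := i - 1) (by grind)
    exact (hG.claw x (f (i - 1)) (f (i + 1)) y (s.adj_left hM hx) (s.adj_right hM) hxy
      (hM.far (by grind)).1 (fun h => h1 (Or.inl h.symm)) (fun h => hy (Or.inl h.symm))
      (hM.far (by grind)).2 (fun h => h1 (Or.inr h.symm)) fun h => hy (Or.inr h.symm)).elim
  · exact (hG.c4 x (f (i + 1)) (f (i + 2)) y (s.adj_right hM) ((hM.adj_iff _ _).2 (by grind))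
      (t.adj_mid hM (by rwa [e1])).symm hxy.symm (fun h => h2 (Or.inl h))
      (fun h => hy (Or.inl h.symm)) (fun h => h2 (Or.inr h)) fun h => hy (Or.inr h.symm)).elim

end IsMinHole

theorem SitsAt.not_forall_adjEq {x : V} {i : ZMod n} (s : G.SitsAt f x i)
    (hM : G.IsMinHole n f) : ¬ ∀ j, G.AdjEq x (f j) :=
  fun h => s.not_adjEq hM (j := i + 2) (by simp) (h _)

namespace IsMinHole

theorem adj_of_between (hM : G.IsMinHole n f) (hG : G.ForbFree) {x y z : V} {i : ZMod n}
    (s : G.SitsAt f x i) (t : G.SitsAt f y (i + 2)) (r : G.SitsAt f z (i + 1))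
    (hxy : G.Adj x y) : G.Adj x z ∧ G.Adj z y := by
  obtain ⟨z1, z2, z3, z4⟩ := ZMod.small_ne_zero hM.five_le
  obtain ⟨hx, hy⟩ := hM.shift_two_of_adj hG s t hxy
  have hxz : x ≠ z := by
    rintro rfl
    exact z1 (by linear_combination hM.sitsAt_unique r s)
  have hzy : z ≠ y := by
    rintro rfl
    exact z1 (by linear_combination hM.sitsAt_unique t r)
  have e1 : i + 1 - 1 = i := by ring
  have e2 : i + 1 + 1 = i + 2 := by ring
  have e3 : i + 2 - 1 = i + 1 := by ring
  have e4 : i + 2 + 1 = i + 3 := by ring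
  have hx0 := s.adj_mid hM hx
  have hx2 := s.not_adjEq hM (j := i + 2) (by simp)
  have hx3 := s.not_adjEq hM (j := i + 3) (by simp)
  have hz2 := r.adj_right hM
  have hzp := r.not_adjEq hM (j := i - 1) (by grind)
  have hz3 := r.not_adjEq hM (j := i + 3) (by grind)
  have hy0 := t.not_adjEq hM (j := i) (by simp)
  have hy3 := t.adj_right hM
  have hp : G.Adj (f (i - 1)) (f i) := (hM.adj_iff _ _).2 (by grind)
  rw [e2] at hz2
  rw [e4] at hy3
  simp only [AdjEq, not_or] at hx hx2 hx3 hzp hz3 hy0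
  by_cases hz : G.AdjEq z (f i)
  · have hz0 := r.adj_left hM (by rwa [e1])
    rw [e1] at hz0
    have h1 : G.Adj x z := by
      by_contra hn
      exact hG.claw (f i) (f (i - 1)) x z hp.symm hx0.symm hz0.symm (Ne.symm hx.1) (Ne.symm hzp.1) hxz
        (fun h => hx.2 h.symm) (fun h => hzp.2 h.symm) hn
    refine ⟨h1, ?_⟩
    rcases t.adj_self with rfl | h2
    · exact hz2
    · by_contra hn
      exact hG.c4 x z (f (i + 2)) y h1 hz2 h2.symm hxy.symm hx2.1 hzy hx2.2 hn
  · have hz1 := r.adj_mid hM (by rwa [e1])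
    have hy1 := t.adj_left hM (by rwa [e3])
    rw [e3] at hy1
    simp only [AdjEq, not_or] at hz
    have h1 : G.Adj z y := by
      by_contra hn
      exact hG.claw (f (i + 1)) (f i) z y (hM.adj_succ i).symm hz1.symm hy1.symm (Ne.symm hz.1)
        (Ne.symm hy0.1) hzy (fun h => hz.2 h.symm) (fun h => hy0.2 h.symm) hn
    refine ⟨?_, h1⟩
    by_contra hn
    exact hG.claw y x z (f (i + 3)) hxy.symm h1.symm hy3 hxz hx3.1 hz3.1 hn hx3.2 hz3.2

/-- If no vertex is complete to a shortest hole, the positions on that hole form a round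
partition. -/
theorem isPHCA [Fintype V] (hM : G.IsMinHole n f) (hG : G.ForbFree) (hconn : G.Connected)
    (hu : ∀ u, ¬ ∀ j, G.AdjEq u (f j)) : G.IsPHCA := by
  have hsit : ∀ x, ∃ i, G.SitsAt f x i := fun x => by
    obtain ⟨k, hk⟩ := hM.exists_adjEq hG hconn x
    exact (hM.forall_or_sitsAt hG hk).resolve_left (hu x)
  choose c hc using hsit
  have hc' : ∀ {x i}, c x = i → G.SitsAt f x i := fun h => h ▸ hc _
  refine RoundPartition.isPHCA hG (m := n) {
    c := c
    five_le := hM.five_le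
    clique := fun x y h hne => (hc' h).adj_of_eq (hc y) hM hG hne
    near := fun x y h => hM.eq_or_of_adj hG (hc x) (hc y) h
    mid := fun x y z h hy hz => hM.adj_of_between hG (hc x) (hc' hy) (hc' hz) h
    no_double := fun x y z h h' hy hz => ?_ }
  have h1 := (hM.shift_two_of_adj hG (hc x) (hc' hy) h).2
  have h2 := (hM.shift_two_of_adj hG (hc y) (hc' hz) h').1
  rw [hy] at h2
  exact h2 (by convert h1 using 3; ring)

section Hub

variable {u : V}

theorem eq_five_of_forall_adjEq (hM : G.IsMinHole n f) (hG : G.ForbFree)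
    (hu : ∀ j, G.AdjEq u (f j)) : n = 5 := by
  by_contra hn
  have h5 := hM.five_le
  have z5 : (5 : ZMod n) ≠ 0 := by
    intro h
    have := (ZMod.natCast_eq_zero_iff 5 n).1 (by exact_mod_cast h)
    have := Nat.le_of_dvd (by norm_num) this
    omega
  obtain ⟨z1, z2, z3, z4⟩ := ZMod.small_ne_zero h5
  have h02 := hM.far (i := 0) (j := 2) (by simp)
  have h24 := hM.far (i := 2) (j := 4) (Or.inl (by norm_num))
  have h04 : f 0 ≠ f 4 ∧ ¬ G.Adj (f 0) (f 4) := by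
    rw [hM.hole.2.1.ne_iff, hM.adj_iff]
    refine ⟨fun h => z4 h.symm, ?_⟩
    rintro (h | h)
    · exact z5 (by linear_combination -h)
    · exact z3 (by linear_combination h)
  have ha := hM.adj_of_forall hu
  exact hG.claw u (f 0) (f 2) (f 4) (ha _) (ha _) (ha _) h02.1 h04.1 h24.1 h02.2 h04.2 h24.2

theorem adjEq_pred_of_hub (hM : G.IsMinHole n f) (hG : G.ForbFree)
    (hu : ∀ j, G.AdjEq u (f j)) {x : V} {i : ZMod n} (s : G.SitsAt f x i) :
    G.AdjEq x (f (i - 1)) := by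
  by_contra hx
  have hx0 := s.adj_mid hM hx
  have hx1 := s.adj_right hM
  have hx2 := s.not_adjEq hM (j := i + 2) (by simp)
  have ha := hM.adj_of_forall hu
  have hp : G.Adj (f (i - 1)) (f i) := (hM.adj_iff _ _).2 (by grind)
  have h12 : G.Adj (f (i + 1)) (f (i + 2)) := (hM.adj_iff _ _).2 (by grind)
  have hp2 := hM.far (i := i - 1) (j := i + 2) (by grind)
  have hp1 := hM.far (i := i - 1) (j := i + 1) (by grind)
  have h02 := hM.far (i := i) (j := i + 2) (by simp)
  simp only [AdjEq, not_or] at hx hx2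
  by_cases h : G.Adj u x
  · exact hG.claw u x (f (i - 1)) (f (i + 2)) h (ha _) (ha _) hx.1 hx2.1 hp2.1 hx.2 hx2.2 hp2.2
  · exact hG.tent u (f i) (f (i + 1)) x (f (i + 2)) (f (i - 1)) (ha _) (ha _) (hM.adj_succ i) h
      h02.2 (fun h => hp1.2 h.symm) (ha _) (ha _) hx0.symm hp.symm hx1.symm h12 hx2.2 hx.2
      (fun h => hp2.2 h.symm)

theorem adj_of_hub (hM : G.IsMinHole n f) (hG : G.ForbFree)
    (hu : ∀ j, G.AdjEq u (f j)) {x : V} {i : ZMod n} (s : G.SitsAt f x i) : G.Adj u x := by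
  obtain ⟨z1, z2, z3, z4⟩ := ZMod.small_ne_zero hM.five_le
  have hM' := hM.update s (hM.adjEq_pred_of_hub hG hu s)
  by_contra hn
  have hne : u ≠ x := by
    rintro rfl
    exact s.not_forall_adjEq hM hu
  have hupd : ∀ k, k ≠ i → G.AdjEq u (Function.update f i x k) := fun k hk => by
    rw [Function.update_of_ne hk]
    exact hu k
  refine hM'.no_run_of_four hG (x := u) (i := i + 1) (hupd _ fun h => z1 (by linear_combination h))
    (hupd _ fun h => z2 (by linear_combination h)) (hupd _ fun h => z3 (by linear_combination h))
    (hupd _ fun h => z4 (by linear_combination h)) ?_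
  rw [add_sub_cancel_right, Function.update_self]
  rintro (h | h)
  · exact hne h
  · exact hn h

theorem adj_succ_of_hub (hM : G.IsMinHole n f) (hG : G.ForbFree)
    (hu : ∀ j, G.AdjEq u (f j)) {x y : V} {i : ZMod n} (s : G.SitsAt f x i)
    (t : G.SitsAt f y (i + 1)) : G.Adj x y := by
  obtain ⟨z1, z2, z3, z4⟩ := ZMod.small_ne_zero hM.five_le
  have hM' := hM.update s (hM.adjEq_pred_of_hub hG hu s)
  by_contra hn
  have hne : y ≠ x := by
    rintro rfl
    exact z1 (by linear_combination hM.sitsAt_unique t s)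
  have hyx : ¬ G.AdjEq y (Function.update f i x i) := by
    rw [Function.update_self]
    rintro (h | h)
    · exact hne h
    · exact hn h.symm
  have hu' : ∀ j, G.AdjEq u (Function.update f i x j) := fun j => by
    rcases eq_or_ne j i with rfl | hj
    · rw [Function.update_self]
      exact Or.inr (hM.adj_of_hub hG hu s)
    · rw [Function.update_of_ne hj]
      exact hu j
  have t' : G.SitsAt (Function.update f i x) y (i + 1) := by
    refine ⟨?_, ?_, fun j hj => ?_⟩
    · rw [Function.update_of_ne fun h => z1 (by linear_combination h)]
      exact t.adj_self
    · rw [Function.update_of_ne fun h => z2 (by linear_combination h)]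
      exact t.adj_succ
    · rcases eq_or_ne j i with rfl | hji
      · exact absurd hj hyx
      · rw [Function.update_of_ne hji] at hj
        exact t.near j hj
  have := hM'.adjEq_pred_of_hub hG hu' t'
  rw [add_sub_cancel_right] at this
  exact hyx this

theorem not_adj_of_hub (hM : G.IsMinHole n f) (hG : G.ForbFree)
    (hu : ∀ j, G.AdjEq u (f j)) {x y : V} {i : ZMod n} (s : G.SitsAt f x i)
    (t : G.SitsAt f y (i + 2)) : ¬ G.Adj x y :=
  hM.not_adj_of_two_apart hG s t (hM.adjEq_pred_of_hub hG hu s)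
    (by convert hM.adjEq_pred_of_hub hG hu t using 2; ring)

theorem adj_hub_hub (hM : G.IsMinHole n f) (hG : G.ForbFree) {u' : V}
    (hu : ∀ j, G.AdjEq u (f j)) (hu' : ∀ j, G.AdjEq u' (f j)) (hne : u ≠ u') : G.Adj u u' := by
  by_contra hn
  have ha := hM.adj_of_forall hu
  have ha' := hM.adj_of_forall hu'
  have h02 := hM.far (i := 0) (j := 2) (by simp)
  exact hG.c4 u (f 0) u' (f 2) (ha _) (ha' _).symm (ha' _) (ha _).symm hne h02.1 hn h02.2

theorem isFatW5 (hM : G.IsMinHole n f) (hG : G.ForbFree) (hconn : G.Connected)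
    (hu : ∀ j, G.AdjEq u (f j)) : G.IsFatW5 := by
  classical
  obtain rfl := hM.eq_five_of_forall_adjEq hG hu
  have hsit : ∀ x, (∀ j, G.AdjEq x (f j)) ∨ ∃ i, G.SitsAt f x i := fun x => by
    obtain ⟨k, hk⟩ := hM.exists_adjEq hG hconn x
    exact hM.forall_or_sitsAt hG hk
  have hpart : ∀ x, ∃ p : Fin 6, (p = 5 ∧ ∀ j, G.AdjEq x (f j)) ∨
      ∃ i : Fin 5, p = Fin.castSucc i ∧ G.SitsAt f x i := fun x => by
    rcases hsit x with h | ⟨i, h⟩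
    · exact ⟨5, Or.inl ⟨rfl, h⟩⟩
    · exact ⟨Fin.castSucc i, Or.inr ⟨i, rfl, h⟩⟩
  choose part hpart using hpart
  have hself : ∀ {x} {i : Fin 5}, G.SitsAt f x i → part x = Fin.castSucc i := by
    intro x i s
    rcases hpart x with ⟨_, h⟩ | ⟨k, hk, h⟩
    · exact absurd h (SitsAt.not_forall_adjEq s hM)
    · rw [hk, show k = i from hM.sitsAt_unique h s]
  refine ⟨part, fun p => ?_, fun x y hne => ?_⟩
  · induction p using Fin.lastCases with
    | last =>
      refine ⟨u, (hpart u).elim (fun h => h.1) ?_⟩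
      rintro ⟨i, -, s⟩
      exact absurd hu (SitsAt.not_forall_adjEq s hM)
    | cast i => exact ⟨f i, hself (hM.sitsAt_self i)⟩
  · have far : ∀ {x y : V} {i j : Fin 5}, G.SitsAt f x i → G.SitsAt f y j →
        j = i + 2 → ¬ G.Adj x y := by
      rintro x y i _ s t rfl
      exact hM.not_adj_of_hub hG hu s t
    have next : ∀ {x y : V} {i j : Fin 5}, G.SitsAt f x i → G.SitsAt f y j →
        j = i + 1 → G.Adj x y := by
      rintro x y i _ s t rfl
      exact hM.adj_succ_of_hub hG hu s t
    rcases hpart x with ⟨px, hx⟩ | ⟨i, px, s⟩ <;> rcases hpart y with ⟨py, hy⟩ | ⟨j, py, t⟩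
    · exact iff_of_true (hM.adj_hub_hub hG hx hy hne) (Or.inr (Or.inl px))
    · exact iff_of_true (hM.adj_of_hub hG hx t) (Or.inr (Or.inl px))
    · exact iff_of_true (hM.adj_of_hub hG hy s).symm (Or.inr (Or.inr (Or.inl py)))
    · rw [px, py]
      have hcases : ∀ i j : Fin 5, (j = i ∨ j = i + 1 ∨ i = j + 1) ∧
            fatW5Rel i.castSucc j.castSucc ∨
          (j = i + 2 ∨ i = j + 2) ∧ ¬ fatW5Rel i.castSucc j.castSucc := by
        unfold fatW5Rel
        decide
      rcases hcases i j with ⟨h, hr⟩ | ⟨h, hr⟩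
      · refine iff_of_true ?_ hr
        rcases h with rfl | h | h
        · exact s.adj_of_eq t hM hG hne
        · exact next s t h
        · exact (next t s h).symm
      · refine iff_of_false ?_ hr
        rcases h with h | h
        · exact far s t h
        · exact fun hxy => far t s h hxy.symm

end Hub

end IsMinHole

end SimpleGraph

/-- A connected {claw, tent S_3, net, C_4}-free graph is either a fat `W_5`
or a proper Helly circular-arc graph. -/
theorem stmt0 {V : Type*} [Fintype V] (G : SimpleGraph V) (hconn : G.Connected)
    (hclaw : ¬ G.HasInducedCopy clawGraph) (htent : ¬ G.HasInducedCopy tentGraph)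
    (hnet : ¬ G.HasInducedCopy netGraph) (hc4 : ¬ G.HasInducedCopy (cycleG 4)) :
    G.IsFatW5 ∨ G.IsPHCA := by
  have hG := SimpleGraph.ForbFree.of_noInducedCopy hclaw htent hnet hc4
  by_cases hh : G.HasHole
  · obtain ⟨n, f, hM⟩ := hG.exists_isMinHole hh
    by_cases hu : ∃ u, ∀ j, G.AdjEq u (f j)
    · obtain ⟨u, hu⟩ := hu
      exact Or.inl (hM.isFatW5 hG hconn hu)
    · exact Or.inr (hM.isPHCA hG hconn (not_exists.1 hu))
  · obtain ⟨a, ha⟩ := hG.exists_isNestedEnd hconn hh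
    exact Or.inr (ha.isPHCA hG hconn)
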